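/- (Field-Changing Theorem) Let H ≤ G, let ψ be a 𝕂G-irrep with ψ ≅ ind_H^G(φ) for a 𝕂H-irrep φ, and let 𝕃 be any field of characteristic zero. Then the following are equivalent: (a) ψ is tightly induced from φ; (b) the irreducible ℚG-representation ψ_ℚ is tightly induced from the irreducible ℚH-representation φ_ℚ; (c) there is a bijective correspondence between the isomorphism classes of 𝕃G-irreps ψ' quasiconjugate to ψ and the isomorphism classes of 𝕃H-irreps φ' quasiconjugate to φ, characterized by the condition that ψ' is tightly induced from φ'. -/

import Mathlib

open scoped Classical

noncomputable section

namespace Genotype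

variable {k : Type} [Field k] {G : Type} [Group G]

/-- The subfield generated (over the prime field `ℚ`) by the values of a function,
e.g. the field `ℚ[ψ]` generated by the values of a character. -/
def charField {X : Type} {k : Type} [Field k] (f : X → k) : Subfield k :=
  Subfield.closure (Set.range f)

theorem mem_charField {X : Type} {k : Type} [Field k] (f : X → k) (x : X) :
    f x ∈ charField f :=
  Subfield.subset_closure ⟨x, rfl⟩

/-- Two functions (typically characters of irreps over possibly different
characteristic-zero fields) are Galois conjugate: there is a Galois extension `M` of `ℚ`
containing (copies of) all their values and a field automorphism `α` of `M` with
`α (f g) = f' g` for all `g`. -/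
def IsGaloisConj {k l : Type} [Field k] [Field l] {G : Type}
    (f : G → k) (f' : G → l) : Prop :=
  ∃ (M : Type) (_ : Field M) (_ : Algebra ℚ M), IsGalois ℚ M ∧
    ∃ (i : charField f →+* M) (j : charField f' →+* M) (α : M ≃+* M),
      ∀ g : G, α (i ⟨f g, mem_charField f g⟩) = j ⟨f' g, mem_charField f' g⟩

/-- Irreducibility of a finite-dimensional representation. -/
def IsIrr (V : FDRep k G) : Prop :=
  Nontrivial V ∧
    ∀ U : Submodule k V, (∀ g : G, ∀ x ∈ U, V.ρ g x ∈ U) → U = ⊥ ∨ U = ⊤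

/-- Faithfulness of a representation. -/
def IsFaithfulRep (V : FDRep k G) : Prop := Function.Injective V.ρ

/-- `f` (the character of an irrep) occurs in the character `c`,
i.e. `c = f + (character of some representation)`. -/
def CharOccurs (f c : G → k) : Prop :=
  ∃ W : FDRep k G, c = f + W.character

/-- `f` (the character of an irrep) occurs in `c` with multiplicity exactly `m`. -/
def CharMult (f c : G → k) (m : ℕ) : Prop :=
  ∃ W : FDRep k G, c = m • f + W.character ∧ ¬ CharOccurs f W.character

/-- `f` is the character of an irreducible representation. -/
def IsIrrChar (f : G → k) : Prop := ∃ V : FDRep k G, IsIrr V ∧ f = V.character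

/-- Restriction of a character to a subgroup. -/
def resChar (H : Subgroup G) (c : G → k) : H → k := fun h => c h

/-- The induced character `ind_H^G f`. -/
def indChar (H : Subgroup G) (f : H → k) : G → k := fun g =>
  (Nat.card H : k)⁻¹ *
    ∑ᶠ x : G, if h : x⁻¹ * g * x ∈ H then f ⟨x⁻¹ * g * x, h⟩ else 0

/-- The character `cψ` (of a `kG`-irrep) is tightly induced from the character `cφ`
(of a `kH`-irrep): `cψ` is the induced character of `cφ`, `cφ` occurs with multiplicity
exactly `1` in the restriction of `cψ`, and no Galois conjugate of `cφ` other than `cφ`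
itself occurs in the restriction of `cψ`. -/
def TightInd (H : Subgroup G) (cψ : G → k) (cφ : H → k) : Prop :=
  cψ = indChar H cφ ∧ CharMult cφ (resChar H cψ) 1 ∧
    ∀ cφ' : H → k, IsIrrChar cφ' → IsGaloisConj cφ cφ' →
      CharOccurs cφ' (resChar H cψ) → cφ' = cφ

/-- Tight induction from a subquotient `H/K` of `G`: tight induction from `H`
of the inflation. -/
def TightIndSub (H : Subgroup G) (K : Subgroup H) [K.Normal]
    (cψ : G → k) (cφ : (H ⧸ K) → k) : Prop :=
  TightInd H cψ (fun h => cφ (QuotientGroup.mk h))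

/-- A group is Roquette if every normal abelian subgroup of it is cyclic. -/
def IsRoquette (P : Type) [Group P] : Prop :=
  ∀ A : Subgroup P, A.Normal → (∀ x ∈ A, ∀ y ∈ A, x * y = y * x) → IsCyclic A

/-- `χ` is the rational form `ψ_ℚ` of `V`: a rational irrep such that `V` occurs in the
scalar extension `k ⊗_ℚ χ`. -/
def IsRatForm [CharZero k] (χ : FDRep ℚ G) (V : FDRep k G) : Prop :=
  IsIrr χ ∧ CharOccurs V.character (fun g => algebraMap ℚ k (χ.character g))

/-- Irreps over possibly different characteristic-zero fields are quasiconjugate if they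
determine the same rational irrep. -/
def Quasiconj {k l : Type} [Field k] [Field l] [CharZero k] [CharZero l] {G : Type} [Group G]
    (V : FDRep k G) (W : FDRep l G) : Prop :=
  ∃ χ : FDRep ℚ G, IsRatForm χ V ∧ IsRatForm χ W

end Genotype

set_option linter.style.haveILetI false
set_option linter.unusedSectionVars false
namespace Genotype

def IsChar {k : Type} [Field k] {G : Type} [Group G] (f : G → k) : Prop :=
  ∃ V : FDRep k G, f = V.character

section rep
variable {k : Type} [Field k] {G : Type} [Group G]
variable {V : Type} [AddCommGroup V] [Module k V] [FiniteDimensional k V]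
variable {W : Type} [AddCommGroup W] [Module k W] [FiniteDimensional k W]

def Irr (ρ : Representation k G V) : Prop :=
  Nontrivial V ∧
    ∀ U : Submodule k V, (∀ g : G, ∀ x ∈ U, ρ g x ∈ U) → U = ⊥ ∨ U = ⊤

theorem isChar_of (ρ : Representation k G V) : IsChar ρ.character :=
  ⟨FDRep.of ρ, rfl⟩

theorem isIrrChar_of (ρ : Representation k G V) (h : Irr ρ) : IsIrrChar ρ.character :=
  ⟨FDRep.of ρ, h, rfl⟩

theorem IsChar.ex {f : G → k} (h : IsChar f) :
    ∃ (V : Type) (_ : AddCommGroup V) (_ : Module k V) (_ : FiniteDimensional k V)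
      (ρ : Representation k G V), f = ρ.character := by
  obtain ⟨V, rfl⟩ := h
  exact ⟨V, inferInstance, inferInstance, inferInstance, V.ρ, rfl⟩

theorem IsIrrChar.ex {f : G → k} (h : IsIrrChar f) :
    ∃ (V : Type) (_ : AddCommGroup V) (_ : Module k V) (_ : FiniteDimensional k V)
      (ρ : Representation k G V), Irr ρ ∧ f = ρ.character := by
  obtain ⟨V, hV, rfl⟩ := h
  exact ⟨V, inferInstance, inferInstance, inferInstance, V.ρ, hV, rfl⟩

theorem IsIrrChar.isChar {f : G → k} (h : IsIrrChar f) : IsChar f := by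
  obtain ⟨V, hV, rfl⟩ := h
  exact ⟨V, rfl⟩

theorem trace_restrict_proj {U : Submodule k V} (A P : V →ₗ[k] V) (hA : ∀ x ∈ U, A x ∈ U)
    (hP : LinearMap.IsProj U P) :
    LinearMap.trace k U (A.restrict hA) = LinearMap.trace k V (A ∘ₗ P) := by
  have h1 : A ∘ₗ P = U.subtype ∘ₗ (A.restrict hA ∘ₗ P.codRestrict U hP.map_mem) := by
    ext x; rfl
  rw [h1, LinearMap.trace_comp_comm']
  congr 1
  ext x
  simp [hP.map_id x x.2]

/-- subrepresentation -/
def subRep (ρ : Representation k G V) (U : Submodule k V) (hU : ∀ g : G, ∀ x ∈ U, ρ g x ∈ U) :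
    Representation k G U where
  toFun g := (ρ g).restrict (hU g)
  map_one' := by ext x; simp
  map_mul' a b := by ext x; simp

theorem subRep_char (ρ : Representation k G V) (U : Submodule k V)
    (hU : ∀ g : G, ∀ x ∈ U, ρ g x ∈ U) (P : V →ₗ[k] V) (hP : LinearMap.IsProj U P) (g : G) :
    (subRep ρ U hU).character g = LinearMap.trace k V (ρ g ∘ₗ P) :=
  trace_restrict_proj (ρ g) P (hU g) hP

theorem IsChar.zero : IsChar (0 : G → k) := by
  have := isChar_of (k := k) (G := G) (V := PUnit) 1
  convert this using 1
  ext g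
  have h0 : (1 : Representation k G PUnit) g = 0 := by ext
  simp only [Representation.character, h0, map_zero, Pi.zero_apply]

theorem IsChar.add {f h : G → k} (hf : IsChar f) (hh : IsChar h) : IsChar (f + h) := by
  obtain ⟨V, _, _, _, ρ, rfl⟩ := hf.ex
  obtain ⟨W, _, _, _, σ, rfl⟩ := hh.ex
  have := isChar_of (ρ.prod σ)
  convert this using 1
  ext g
  exact (LinearMap.trace_prodMap' (ρ g) (σ g)).symm

theorem IsChar.sum {s : Multiset (G → k)} (hs : ∀ f ∈ s, IsChar f) : IsChar s.sum := by
  induction s using Multiset.induction_on with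
  | empty => exact IsChar.zero
  | cons a s ih =>
    rw [Multiset.sum_cons]
    exact (hs a (by simp)).add (ih fun f hf => hs f (by simp [hf]))

theorem IsChar.conj {f : G → k} (h : IsChar f) (x g : G) : f (x * g * x⁻¹) = f g := by
  obtain ⟨V, rfl⟩ := h
  exact V.char_conj g x

theorem IsChar.one {f : G → k} (h : IsChar f) : ∃ n : ℕ, f 1 = n := by
  obtain ⟨V, rfl⟩ := h
  exact ⟨_, V.char_one⟩

theorem IsIrrChar.one {f : G → k} (h : IsIrrChar f) : ∃ n : ℕ, 0 < n ∧ f 1 = n := by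
  obtain ⟨V, hV, rfl⟩ := h
  haveI := hV.1
  exact ⟨_, Module.finrank_pos (R := k) (M := V), V.char_one⟩

variable [Fintype G] [CharZero k]

theorem exists_proj (ρ : Representation k G V) (U : Submodule k V)
    (hU : ∀ g : G, ∀ x ∈ U, ρ g x ∈ U) :
    ∃ P : V →ₗ[k] V, LinearMap.IsProj U P ∧ ∀ g x, P (ρ g x) = ρ g (P x) := by
  obtain ⟨p, hp⟩ := Submodule.exists_isCompl U
  let p0 : V →ₗ[k] V := U.subtype ∘ₗ Submodule.projectionOnto U p hp
  have hp0 : ∀ x ∈ U, p0 x = x := by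
    intro x hx
    simp only [p0, LinearMap.comp_apply]
    exact congrArg Subtype.val (Submodule.projectionOnto_apply_left hp ⟨x, hx⟩)
  have hp1 : ∀ x, p0 x ∈ U := fun x => (Submodule.projectionOnto U p hp x).2
  have hc : (Fintype.card G : k) ≠ 0 := Nat.cast_ne_zero.2 Fintype.card_ne_zero
  refine ⟨(Fintype.card G : k)⁻¹ • ∑ g : G, ρ g ∘ₗ p0 ∘ₗ ρ g⁻¹, ⟨?_, ?_⟩, ?_⟩
  · intro x
    simp only [LinearMap.smul_apply, LinearMap.sum_apply, LinearMap.comp_apply]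
    exact U.smul_mem _ (U.sum_mem fun g _ => hU _ _ (hp1 _))
  · intro x hx
    simp only [LinearMap.smul_apply, LinearMap.sum_apply, LinearMap.comp_apply]
    have : ∀ g : G, ρ g (p0 (ρ g⁻¹ x)) = x := by
      intro g
      rw [hp0 _ (hU _ _ hx), ← Module.End.mul_apply, ← map_mul]; simp
    simp only [this, Finset.sum_const, Finset.card_univ]
    rw [← Nat.cast_smul_eq_nsmul k, smul_smul, inv_mul_cancel₀ hc, one_smul]
  · intro g x
    simp only [LinearMap.smul_apply, LinearMap.sum_apply, LinearMap.comp_apply, map_smul, map_sum]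
    congr 1
    rw [← Equiv.sum_comp (Equiv.mulLeft g)]
    refine Finset.sum_congr rfl fun h _ => ?_
    simp only [Equiv.coe_mulLeft, map_mul, mul_inv_rev, Module.End.mul_apply]
    congr 3
    rw [← Module.End.mul_apply (ρ g⁻¹), ← map_mul]; simp

theorem decomp_aux : ∀ (n : ℕ) (V : Type) [AddCommGroup V] [Module k V] [FiniteDimensional k V]
    (ρ : Representation k G V), Module.finrank k V = n →
    ∃ s : Multiset (G → k), (∀ f ∈ s, IsIrrChar f) ∧ ρ.character = s.sum := by
  intro n
  induction n using Nat.strong_induction_on with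
  | _ n ih =>
  intro V _ _ _ ρ hn
  rcases subsingleton_or_nontrivial V with hs | hnt
  · refine ⟨0, by simp, ?_⟩
    ext g
    have : ρ g = 0 := by ext x; exact Subsingleton.elim _ _
    simp [Representation.character, this]
  by_cases hI : Irr ρ
  · exact ⟨{ρ.character}, by simpa using isIrrChar_of ρ hI, by simp⟩
  have : ∃ U : Submodule k V, (∀ g : G, ∀ x ∈ U, ρ g x ∈ U) ∧ U ≠ ⊥ ∧ U ≠ ⊤ := by
    by_contra hcon
    push Not at hcon
    refine hI ⟨hnt, fun U hU => ?_⟩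
    by_cases hb : U = ⊥
    · exact Or.inl hb
    · exact Or.inr (hcon U hU hb)
  obtain ⟨U, hU, hb, ht⟩ := this
  obtain ⟨P, hP, hPc⟩ := exists_proj ρ U hU
  let U' := LinearMap.ker P
  have hU' : ∀ g : G, ∀ x ∈ U', ρ g x ∈ U' := by
    intro g x hx
    simp only [U', LinearMap.mem_ker] at hx ⊢
    rw [hPc, hx, map_zero]
  have hP' : LinearMap.IsProj U' (1 - P) := by
    refine ⟨fun x => ?_, fun x hx => ?_⟩
    · simp only [U', LinearMap.mem_ker, LinearMap.sub_apply, Module.End.one_apply, map_sub]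
      rw [hP.map_id (P x) (hP.map_mem x), sub_self]
    · simp only [U', LinearMap.mem_ker] at hx
      simp [hx]
  have l1 : Module.finrank k U < n := hn ▸ Submodule.finrank_lt ht
  have l2 : Module.finrank k U' < n := by
    refine hn ▸ Submodule.finrank_lt ?_
    intro h
    apply hb
    rw [eq_bot_iff]
    intro x hx
    have : x ∈ U' := h ▸ Submodule.mem_top
    simp only [U', LinearMap.mem_ker] at this
    rw [hP.map_id x hx] at this
    simpa using this
  obtain ⟨s, hs, hs'⟩ := ih _ l1 U (subRep ρ U hU) rfl
  obtain ⟨t, ht, ht'⟩ := ih _ l2 U' (subRep ρ U' hU') rfl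
  refine ⟨s + t, ?_, ?_⟩
  · intro f hf
    rcases Multiset.mem_add.1 hf with h | h
    · exact hs f h
    · exact ht f h
  · rw [Multiset.sum_add, ← hs', ← ht']
    ext g
    rw [Pi.add_apply, subRep_char ρ U hU P hP, subRep_char ρ U' hU' _ hP', ← map_add,
      ← LinearMap.comp_add, add_sub_cancel]
    rfl

theorem IsChar.decomp {f : G → k} (hf : IsChar f) :
    ∃ s : Multiset (G → k), (∀ f ∈ s, IsIrrChar f) ∧ f = s.sum := by
  obtain ⟨V, _, _, _, ρ, rfl⟩ := hf.ex
  exact decomp_aux _ V ρ rfl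

end rep

/-- inner product -/
def ip {k : Type} [Field k] {G : Type} [Group G] [Fintype G] (f h : G → k) : k :=
  (Fintype.card G : k)⁻¹ * ∑ g : G, f g⁻¹ * h g

section ipsec
variable {k : Type} [Field k] {G : Type} [Group G] [Fintype G]

theorem ip_add_left (f f' h : G → k) : ip (f + f') h = ip f h + ip f' h := by
  simp [ip, add_mul, Finset.sum_add_distrib, mul_add]

theorem ip_add_right (f h h' : G → k) : ip f (h + h') = ip f h + ip f h' := by
  simp [ip, Finset.sum_add_distrib, mul_add]

theorem ip_smul_right (c : k) (f h : G → k) : ip f (c • h) = c * ip f h := by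
  simp only [ip, Pi.smul_apply, smul_eq_mul, Finset.mul_sum]
  refine Finset.sum_congr rfl fun g _ => by ring

theorem ip_comm (f h : G → k) : ip f h = ip h f := by
  unfold ip
  congr 1
  rw [← Equiv.sum_comp (Equiv.inv G)]
  refine Finset.sum_congr rfl fun g _ => by simp [mul_comm]

theorem ip_smul_left (c : k) (f h : G → k) : ip (c • f) h = c * ip f h := by
  rw [ip_comm, ip_smul_right, ip_comm]

theorem ip_map {l : Type} [Field l] (κ : k →+* l) (f h : G → k) :
    ip (fun g => κ (f g)) (fun g => κ (h g)) = κ (ip f h) := by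
  simp [ip, map_sum]

theorem ip_zero_right (f : G → k) : ip f 0 = 0 := by simp [ip]

theorem ip_sum_right (f : G → k) (s : Multiset (G → k)) :
    ip f s.sum = (s.map (ip f)).sum := by
  induction s using Multiset.induction_on with
  | empty => simp [ip]
  | cons a s ih => simp [ip_add_right, ih]

variable [CharZero k]

theorem ip_rep {V W : Type} [AddCommGroup V] [Module k V] [FiniteDimensional k V]
    [AddCommGroup W] [Module k W] [FiniteDimensional k W]
    (ρ : Representation k G V) (σ : Representation k G W) :
    ip ρ.character σ.character = Module.finrank k (Representation.IntertwiningMap ρ σ) := by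
  haveI : Invertible (Nat.card G : k) := invertibleOfNonzero
    (by rw [Nat.card_eq_fintype_card]; exact Nat.cast_ne_zero.2 Fintype.card_ne_zero)
  rw [← Representation.card_inv_mul_sum_char_mul_char_eq_finrank, Nat.card_eq_fintype_card]
  simp [ip, mul_comm]

theorem ip_nat {f h : G → k} (hf : IsChar f) (hh : IsChar h) : ∃ n : ℕ, ip f h = n := by
  obtain ⟨V, _, _, _, ρ, rfl⟩ := hf.ex
  obtain ⟨W, _, _, _, σ, rfl⟩ := hh.ex
  exact ⟨_, ip_rep ρ σ⟩

theorem ip_self_pos {f : G → k} (hf : IsIrrChar f) : ∃ n : ℕ, 0 < n ∧ ip f f = n := by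
  obtain ⟨V, _, _, _, ρ, hV, rfl⟩ := hf.ex
  refine ⟨_, ?_, ip_rep ρ ρ⟩
  haveI := hV.1
  haveI : Nontrivial (Representation.IntertwiningMap ρ ρ) := by
    refine ⟨⟨Representation.IntertwiningMap.id ρ, 0, ?_⟩⟩
    intro h
    obtain ⟨x, hx⟩ := exists_ne (0 : V)
    exact hx (congrArg (fun f => f.toLinearMap x) h)
  exact Module.finrank_pos

theorem ip_ne_zero_eq {f h : G → k} (hf : IsIrrChar f) (hh : IsIrrChar h) (hn : ip f h ≠ 0) :
    f = h := by
  obtain ⟨V, _, _, _, ρ, hV, rfl⟩ := hf.ex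
  obtain ⟨W, _, _, _, σ, hW, rfl⟩ := hh.ex
  rw [ip_rep] at hn
  have : Nontrivial (Representation.IntertwiningMap ρ σ) := by
    by_contra hc
    rw [not_nontrivial_iff_subsingleton] at hc
    exact hn (by rw [Module.finrank_zero_of_subsingleton]; simp)
  obtain ⟨T, hT⟩ := exists_ne (0 : Representation.IntertwiningMap ρ σ)
  have hTc : ∀ g x, T.toLinearMap (ρ g x) = σ g (T.toLinearMap x) := by
    intro g x
    exact LinearMap.congr_fun (T.isIntertwining' g) x
  have hT0 : T.toLinearMap ≠ 0 := by
    intro h0; apply hT; ext x; exact LinearMap.congr_fun h0 x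
  have hk : LinearMap.ker T.toLinearMap = ⊥ := by
    rcases hV.2 (LinearMap.ker T.toLinearMap) (by
      intro g x hx; rw [LinearMap.mem_ker] at hx ⊢; rw [hTc, hx, map_zero]) with h | h
    · exact h
    · exact absurd (LinearMap.ker_eq_top.1 h) hT0
  have hr : LinearMap.range T.toLinearMap = ⊤ := by
    rcases hW.2 (LinearMap.range T.toLinearMap) (by
      rintro g _ ⟨x, rfl⟩; exact ⟨ρ g x, hTc g x⟩) with h | h
    · exact absurd (LinearMap.range_eq_bot.1 h) hT0
    · exact h
  let E := LinearEquiv.ofBijective T.toLinearMap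
    ⟨LinearMap.ker_eq_bot.1 hk, LinearMap.range_eq_top.1 hr⟩
  ext g
  unfold Representation.character
  rw [← LinearMap.trace_conj' (ρ g) E]
  congr 1
  ext y
  obtain ⟨x, rfl⟩ := E.surjective y
  simp only [LinearEquiv.conj_apply, LinearMap.comp_apply, LinearEquiv.coe_coe,
    LinearEquiv.symm_apply_apply]
  exact hTc g x

theorem ip_ne_iff {f h : G → k} (hf : IsIrrChar f) (hh : IsIrrChar h) : ip f h ≠ 0 ↔ f = h := by
  refine ⟨ip_ne_zero_eq hf hh, ?_⟩
  rintro rfl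
  obtain ⟨n, hn, h⟩ := ip_self_pos hf
  rw [h]; exact_mod_cast hn.ne'

theorem occurs_iff {f c : G → k} : CharOccurs f c ↔ ∃ w, IsChar w ∧ c = f + w := by
  constructor
  · rintro ⟨W, h⟩; exact ⟨_, ⟨W, rfl⟩, h⟩
  · rintro ⟨_, ⟨W, rfl⟩, h⟩; exact ⟨W, h⟩

theorem occurs_of_mem {f : G → k} {s : Multiset (G → k)} (hs : ∀ f ∈ s, IsIrrChar f)
    (hf : f ∈ s) : CharOccurs f s.sum := by
  obtain ⟨t, rfl⟩ := Multiset.exists_cons_of_mem hf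
  rw [occurs_iff, Multiset.sum_cons]
  exact ⟨_, IsChar.sum fun h hh => (hs h (by simp [hh])).isChar, rfl⟩

theorem occurs_of_ip {f c : G → k} (hf : IsIrrChar f) (hc : IsChar c) (h : ip f c ≠ 0) :
    CharOccurs f c := by
  obtain ⟨s, hs, rfl⟩ := hc.decomp
  rw [ip_sum_right] at h
  have : ∃ u ∈ s, ip f u ≠ 0 := by
    by_contra hcon
    push Not at hcon
    exact h (Multiset.sum_eq_zero (by simpa using hcon))
  obtain ⟨u, hu, hne⟩ := this
  rw [ip_ne_zero_eq hf (hs u hu) hne]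
  exact occurs_of_mem hs hu

/-- occurrence gives inequality -/
theorem ip_of_occurs {f c : G → k} (h : CharOccurs f c) {u : G → k}
    (hu : IsChar u) : ∃ n : ℕ, ip u c = ip u f + n := by
  rw [occurs_iff] at h
  obtain ⟨w, hw, rfl⟩ := h
  obtain ⟨n, hn⟩ := ip_nat hu hw
  exact ⟨n, by rw [ip_add_right, hn]⟩

theorem ip_ne_of_occurs {f c : G → k} (hf : IsIrrChar f) (h : CharOccurs f c) :
    ip f c ≠ 0 := by
  obtain ⟨n, hn⟩ := ip_of_occurs h hf.isChar
  obtain ⟨m, hm, hm'⟩ := ip_self_pos hf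
  rw [hn, hm']
  norm_cast
  omega

end ipsec
end Genotype

namespace Genotype

section
variable {k : Type} [Field k] {G : Type} [Group G]

theorem IsChar.map {l : Type} [Field l] (κ : k →+* l) {f : G → k} (hf : IsChar f) :
    IsChar (fun g => κ (f g)) := by
  obtain ⟨V, _, _, _, ρ, rfl⟩ := hf.ex
  letI := κ.toAlgebra
  let σ : Representation l G (TensorProduct k l V) :=
    { toFun := fun g => (ρ g).baseChange l
      map_one' := by rw [map_one]; exact LinearMap.baseChange_id
      map_mul' := fun a b => by rw [map_mul]; exact LinearMap.baseChange_comp _ _ }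
  have := isChar_of σ
  convert this using 1
  ext g
  exact (LinearMap.trace_baseChange (ρ g) l).symm

theorem IsChar.res {f : G → k} (hf : IsChar f) (H : Subgroup G) : IsChar (resChar H f) := by
  obtain ⟨V, _, _, _, ρ, rfl⟩ := hf.ex
  exact isChar_of (ρ.comp H.subtype)

theorem IsChar.mul {f h : G → k} (hf : IsChar f) (hh : IsChar h) : IsChar (f * h) := by
  obtain ⟨V, _, _, _, ρ, rfl⟩ := hf.ex
  obtain ⟨W, _, _, _, σ, rfl⟩ := hh.ex
  rw [← Representation.char_tensor]
  exact isChar_of _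

theorem trace_funLeft {X : Type} [Fintype X] (f : X → X) :
    LinearMap.trace k (X → k) (LinearMap.funLeft k k f) = ∑ x, if f x = x then 1 else 0 := by
  rw [LinearMap.trace_eq_matrix_trace k (Pi.basisFun k X)]
  simp only [Matrix.trace, Matrix.diag, LinearMap.toMatrix_apply, Pi.basisFun_apply,
    Pi.basisFun_repr, LinearMap.funLeft_apply]
  refine Finset.sum_congr rfl fun x _ => ?_
  rw [Pi.single_apply]

theorem IsChar.perm {X : Type} [Fintype X] (a : G → X → X) (h1 : a 1 = id)
    (hm : ∀ g h x, a (g * h) x = a h (a g x)) :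
    IsChar (fun g => ∑ x, if a g x = x then (1 : k) else 0) := by
  let σ : Representation k G (X → k) :=
    { toFun := fun g => LinearMap.funLeft k k (a g)
      map_one' := by rw [h1]; rfl
      map_mul' := fun g h => by
        ext F x
        simp [LinearMap.funLeft_apply, hm] }
  have := isChar_of σ
  convert this using 1
  ext g
  exact (trace_funLeft _).symm

variable [Fintype G]

theorem IsChar.reg : IsChar (fun g : G => if g = 1 then (Fintype.card G : k) else 0) := by
  have := IsChar.perm (k := k) (G := G) (X := G) (fun g x => g⁻¹ * x) (by ext; simp)
    (by intros; simp [mul_assoc])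
  convert this using 1
  ext g
  by_cases h : g = 1 <;> simp [h]

theorem IsChar.avg [CharZero k] {A : Type} [Group A] [Fintype A] {f : A × G → k} (hf : IsChar f) :
    IsChar (fun g => (Fintype.card A : k)⁻¹ * ∑ a, f (a, g)) := by
  obtain ⟨V, _, _, _, τ, rfl⟩ := hf.ex
  let P : V →ₗ[k] V := (Fintype.card A : k)⁻¹ • ∑ a, τ (a, 1)
  have hc : (Fintype.card A : k) ≠ 0 := Nat.cast_ne_zero.2 Fintype.card_ne_zero
  let U : Submodule k V := Representation.invariants (τ.comp (MonoidHom.inl A G))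
  have hUm : ∀ x, x ∈ U ↔ ∀ a, τ (a, 1) x = x := fun x => Iff.rfl
  let ρ : Representation k G V := τ.comp (MonoidHom.inr A G)
  have hρ : ∀ g, ρ g = τ (1, g) := fun g => rfl
  have hU : ∀ g : G, ∀ x ∈ U, ρ g x ∈ U := by
    intro g x hx
    rw [hUm] at hx ⊢
    intro a
    rw [hρ, ← Module.End.mul_apply, ← map_mul]
    have : ((a, 1) : A × G) * (1, g) = (1, g) * (a, 1) := by ext <;> simp
    rw [this, map_mul, Module.End.mul_apply, hx a]
  have hP : LinearMap.IsProj U P := by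
    constructor
    · intro x
      rw [hUm]
      intro a
      simp only [P, LinearMap.smul_apply, LinearMap.sum_apply, map_smul, map_sum]
      congr 1
      conv_rhs => rw [← Equiv.sum_comp (Equiv.mulLeft a)]
      refine Finset.sum_congr rfl fun b _ => ?_
      rw [← Module.End.mul_apply, ← map_mul]
      simp
    · intro x hx
      rw [hUm] at hx
      simp only [P, LinearMap.smul_apply, LinearMap.sum_apply, hx, Finset.sum_const,
        Finset.card_univ]
      rw [← Nat.cast_smul_eq_nsmul k, smul_smul, inv_mul_cancel₀ hc, one_smul]
  have := isChar_of (subRep ρ U hU)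
  convert this using 1
  ext g
  rw [subRep_char ρ U hU P hP]
  simp only [P, LinearMap.comp_smul, map_smul, smul_eq_mul]
  congr 1
  have : ρ g ∘ₗ ∑ a, τ (a, 1) = ∑ a, τ (a, g) := by
    ext x
    simp only [LinearMap.comp_apply, LinearMap.sum_apply, map_sum]
    refine Finset.sum_congr rfl fun a _ => ?_
    rw [hρ, ← Module.End.mul_apply, ← map_mul]
    simp
  rw [this, map_sum]
  rfl

/-- extension by zero -/
def ext0 (H : Subgroup G) (f : H → k) (y : G) : k := if h : y ∈ H then f ⟨y, h⟩ else 0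

theorem indChar_eq (H : Subgroup G) [Fintype H] (f : H → k) (g : G) :
    indChar H f g = (Fintype.card H : k)⁻¹ * ∑ x : G, ext0 H f (x⁻¹ * g * x) := by
  unfold indChar
  rw [finsum_eq_sum_of_fintype, Nat.card_eq_fintype_card]
  rfl

theorem sum_ext0 (H : Subgroup G) [Fintype H] (f : H → k) (u : G → k) :
    ∑ y : G, ext0 H f y * u y = ∑ h : H, f h * u h := by
  have h1 : ∀ h : H, f h * u h = ext0 H f h * u h := by
    intro h; simp [ext0]
  simp only [h1]
  rw [← Finset.sum_subtype (p := fun y => y ∈ H) (Finset.univ.filter (fun y => y ∈ H))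
    (by simp) (fun y => ext0 H f y * u y), Finset.sum_filter]
  refine Finset.sum_congr rfl fun y _ => ?_
  by_cases hy : y ∈ H <;> simp [ext0, hy]

theorem IsChar.ind [CharZero k] (H : Subgroup G) [Fintype H] {f : H → k} (hf : IsChar f) :
    IsChar (indChar H f) := by
  have h1 : IsChar (fun p : H × G => f p.1) := by
    obtain ⟨V, _, _, _, ρ, rfl⟩ := hf.ex
    exact isChar_of (ρ.comp (MonoidHom.fst H G))
  have h2 := IsChar.perm (k := k) (G := H × G) (X := G) (fun p x => (p.1 : G)⁻¹ * x * p.2)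
    (by ext; simp) (by intros; simp [mul_assoc])
  have := (h1.mul h2).avg
  convert this using 1
  ext g
  rw [indChar_eq]
  congr 1
  simp only [Pi.mul_apply]
  simp only [Finset.mul_sum]
  rw [Finset.sum_comm, ← Equiv.sum_comp (Equiv.inv G)]
  refine Finset.sum_congr rfl fun x _ => ?_
  rw [← sum_ext0 H f (fun h => if h⁻¹ * x * g = x then 1 else 0)]
  rw [Finset.sum_eq_single (x * g * x⁻¹)]
  · simp [mul_assoc]
  · intro b _ hb
    have : ¬ (b⁻¹ * x * g = x) := by
      intro h
      apply hb
      rw [mul_assoc, inv_mul_eq_iff_eq_mul] at h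
      rw [h]; simp
    simp [this]
  · simp

theorem frob [CharZero k] (H : Subgroup G) [Fintype H] (f : H → k) (c : G → k)
    (hc : ∀ x g, c (x * g * x⁻¹) = c g) : ip (indChar H f) c = ip f (resChar H c) := by
  have hG : (Fintype.card G : k) ≠ 0 := Nat.cast_ne_zero.2 Fintype.card_ne_zero
  have key : ∀ x : G, ∑ g : G, ext0 H f (x⁻¹ * g⁻¹ * x) * c g = ∑ h : H, f h⁻¹ * c h := by
    intro x
    rw [← Equiv.sum_comp (MulAut.conj x).toEquiv, ← Equiv.sum_comp (Equiv.inv H),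
      ← Equiv.sum_comp (Equiv.inv G)]
    refine Eq.trans ?_ ((sum_ext0 H f (fun g => c g⁻¹)).trans ?_)
    · refine Finset.sum_congr rfl fun y _ => ?_
      have e1 : (MulAut.conj x).toEquiv ((Equiv.inv G) y) = x * y⁻¹ * x⁻¹ := rfl
      rw [e1, hc]
      simp [mul_assoc]
    · refine Finset.sum_congr rfl fun y _ => ?_
      simp
  unfold ip
  have : ∀ g : G, indChar H f g⁻¹ * c g =
      (Fintype.card H : k)⁻¹ * ∑ x : G, ext0 H f (x⁻¹ * g⁻¹ * x) * c g := by
    intro g; rw [indChar_eq, mul_assoc, Finset.sum_mul]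
  simp only [this]
  rw [← Finset.mul_sum, Finset.sum_comm]
  simp only [key, Finset.sum_const, Finset.card_univ, nsmul_eq_mul]
  rw [mul_left_comm, inv_mul_cancel_left₀ hG]
  rfl

theorem indChar_add (H : Subgroup G) [Fintype H] (f f' : H → k) :
    indChar H (f + f') = indChar H f + indChar H f' := by
  ext g
  simp only [indChar_eq, Pi.add_apply, ← mul_add, ← Finset.sum_add_distrib]
  congr 1
  refine Finset.sum_congr rfl fun x _ => ?_
  unfold ext0
  split_ifs <;> simp

theorem indChar_smul (H : Subgroup G) [Fintype H] (c : k) (f : H → k) :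
    indChar H (c • f) = c • indChar H f := by
  ext g
  simp only [indChar_eq, Pi.smul_apply, smul_eq_mul, mul_left_comm c, Finset.mul_sum]
  refine Finset.sum_congr rfl fun x _ => ?_
  unfold ext0
  split_ifs <;> simp

theorem indChar_map {l : Type} [Field l] (κ : k →+* l) (H : Subgroup G) [Fintype H] (f : H → k) :
    indChar H (fun h => κ (f h)) = fun g => κ (indChar H f g) := by
  ext g
  simp only [indChar_eq, map_mul, map_inv₀, map_natCast, map_sum]
  congr 1
  refine Finset.sum_congr rfl fun x _ => ?_
  unfold ext0
  split_ifs <;> simp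

theorem indChar_zero (H : Subgroup G) [Fintype H] : indChar H (0 : H → k) = 0 := by
  ext g
  simp [indChar_eq, ext0]

theorem indChar_sum (H : Subgroup G) [Fintype H] (s : Multiset (H → k)) :
    indChar H s.sum = (s.map (indChar H)).sum := by
  induction s using Multiset.induction_on with
  | empty => simp [indChar_zero]
  | cons a s ih => simp [indChar_add, ih]

theorem indChar_pow (H : Subgroup G) [Fintype H] (f : H → k) (c d : ℕ)
    (hcd : ∀ g : G, (g ^ c) ^ d = g) :
    indChar H (fun h => f (h ^ c)) = fun g => indChar H f (g ^ c) := by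
  ext g
  simp only [indChar_eq]
  congr 1
  refine Finset.sum_congr rfl fun x _ => ?_
  have h1 : x⁻¹ * g ^ c * x = (x⁻¹ * g * x) ^ c := by
    have := conj_pow (i := c) (a := x⁻¹) (b := g)
    simpa using this.symm
  rw [h1]
  generalize x⁻¹ * g * x = y
  unfold ext0
  by_cases hy : y ∈ H
  · rw [dif_pos hy, dif_pos (H.pow_mem hy c)]; rfl
  · rw [dif_neg hy, dif_neg]
    intro h; apply hy; rw [← hcd y]; exact H.pow_mem h d

theorem resChar_add (H : Subgroup G) (f f' : G → k) :
    resChar H (f + f') = resChar H f + resChar H f' := rfl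

theorem resChar_sum (H : Subgroup G) (s : Multiset (G → k)) :
    resChar H s.sum = (s.map (resChar H)).sum := by
  induction s using Multiset.induction_on with
  | empty => rfl
  | cons a s ih => simp [resChar_add, ih]

end
end Genotype

namespace Genotype

/-- convolution -/
def conv {k : Type} [Field k] {G : Type} [Group G] [Fintype G] (f h : G → k) : G → k :=
  fun x => ∑ g : G, f g * h (g⁻¹ * x)

section
variable {k : Type} [Field k] {G : Type} [Group G] [Fintype G]

theorem conv_add_right (f h h' : G → k) : conv f (h + h') = conv f h + conv f h' := by
  ext x; simp [conv, mul_add, Finset.sum_add_distrib]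

theorem conv_smul_left (c : k) (f h : G → k) : conv (c • f) h = c • conv f h := by
  ext x; simp [conv, Finset.mul_sum, mul_assoc]

theorem conv_smul_right (c : k) (f h : G → k) : conv f (c • h) = c • conv f h := by
  ext x; simp [conv, Finset.mul_sum, mul_left_comm]

theorem conv_zero_right (f : G → k) : conv f 0 = 0 := by
  ext x; simp [conv]

theorem conv_zero_left (f : G → k) : conv 0 f = 0 := by
  ext x; simp [conv]

theorem conv_msum_right (f : G → k) (s : Multiset (G → k)) :
    conv f s.sum = (s.map (conv f)).sum := by
  induction s using Multiset.induction_on with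
  | empty => simp [conv_zero_right]
  | cons a s ih => simp [conv_add_right, ih]

theorem conv_fsum_left {ι : Type} (s : Finset ι) (F : ι → G → k) (h : G → k) :
    conv (∑ i ∈ s, F i) h = ∑ i ∈ s, conv (F i) h := by
  ext x
  simp only [conv, Finset.sum_apply, Finset.sum_mul]
  rw [Finset.sum_comm]

theorem conv_fsum_right {ι : Type} (s : Finset ι) (F : ι → G → k) (h : G → k) :
    conv h (∑ i ∈ s, F i) = ∑ i ∈ s, conv h (F i) := by
  ext x
  simp only [conv, Finset.sum_apply, Finset.mul_sum]
  rw [Finset.sum_comm]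

theorem conv_comm (f h : G → k) (hf : ∀ x g, f (x * g * x⁻¹) = f g) : conv f h = conv h f := by
  ext x
  simp only [conv]
  rw [← Equiv.sum_comp ((Equiv.inv G).trans (Equiv.mulLeft x))]
  refine Finset.sum_congr rfl fun g _ => ?_
  have := hf g (g⁻¹ * x)
  simp only [mul_inv_cancel_left] at this
  simp [← this, mul_comm]

theorem conv_map {l : Type} [Field l] (κ : k →+* l) (f h : G → k) :
    conv (fun g => κ (f g)) (fun g => κ (h g)) = fun g => κ (conv f h g) := by
  ext x
  simp [conv, map_sum]

theorem conv_one (f h : G → k) (hc : (Fintype.card G : k) ≠ 0) :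
    conv f h 1 = Fintype.card G * ip f h := by
  unfold conv ip
  rw [mul_inv_cancel_left₀ hc, ← Equiv.sum_comp (Equiv.inv G)]
  simp

variable {V : Type} [AddCommGroup V] [Module k V] [FiniteDimensional k V]
variable {W : Type} [AddCommGroup W] [Module k W] [FiniteDimensional k W]

/-- action of a function -/
def zop (ρ : Representation k G V) (v : G → k) : V →ₗ[k] V := ∑ g : G, v g • ρ g⁻¹

theorem trace_zop (ρ : Representation k G V) (v : G → k) (x : G) :
    LinearMap.trace k V (zop ρ v * ρ x) = conv v ρ.character x := by
  simp only [zop, Finset.sum_mul, map_sum, conv]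
  refine Finset.sum_congr rfl fun g _ => ?_
  rw [smul_mul_assoc, map_smul, ← map_mul]
  rfl

theorem zop_mul (ρ : Representation k G V) (v w : G → k) :
    zop ρ v * zop ρ w = zop ρ (conv w v) := by
  simp only [zop, conv, Finset.sum_mul, Finset.mul_sum, Finset.sum_smul]
  conv_rhs => rw [Finset.sum_comm]
  refine Finset.sum_congr rfl fun h _ => ?_
  rw [← Equiv.sum_comp (Equiv.mulLeft h) (fun y => (w h * v (h⁻¹ * y)) • ρ y⁻¹)]
  refine Finset.sum_congr rfl fun g _ => ?_
  simp [smul_smul, mul_comm]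

theorem zop_comm (ρ : Representation k G V) (v : G → k) (hv : ∀ x g, v (x * g * x⁻¹) = v g)
    (y : G) : zop ρ v * ρ y = ρ y * zop ρ v := by
  simp only [zop, Finset.sum_mul, Finset.mul_sum]
  rw [← Equiv.sum_comp (MulAut.conj y).toEquiv]
  refine Finset.sum_congr rfl fun g _ => ?_
  have : (MulAut.conj y).toEquiv g = y * g * y⁻¹ := rfl
  rw [this, hv, smul_mul_assoc, mul_smul_comm, ← map_mul, ← map_mul]
  simp [mul_assoc]

theorem irr_inj {ρ : Representation k G V} (h : Irr ρ) (A : V →ₗ[k] V)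
    (hA : ∀ y, A * ρ y = ρ y * A) : A = 0 ∨ Function.Injective A := by
  rcases h.2 (LinearMap.ker A) (by
    intro g x hx; rw [LinearMap.mem_ker] at hx ⊢
    rw [← Module.End.mul_apply, hA, Module.End.mul_apply, hx, map_zero]) with h | h
  · exact Or.inr (LinearMap.ker_eq_bot.1 h)
  · exact Or.inl (LinearMap.ker_eq_top.1 h)

theorem idem_irr {v f : G → k} (hv : ∀ x g, v (x * g * x⁻¹) = v g) (hvv : conv v v = v)
    (hf : IsIrrChar f) : conv v f = f ∨ conv v f = 0 := by
  obtain ⟨V, _, _, _, ρ, hV, rfl⟩ := hf.ex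
  have hid : zop ρ v * zop ρ v = zop ρ v := by rw [zop_mul, hvv]
  rcases irr_inj hV (zop ρ v) (zop_comm ρ v hv) with h | h
  · right
    ext x
    rw [← trace_zop, h]; simp
  · left
    have h1 : zop ρ v = 1 := by
      ext x
      exact h (LinearMap.congr_fun hid x)
    ext x
    rw [← trace_zop, h1, one_mul]; rfl

variable [CharZero k]

theorem hom_zero {ρ : Representation k G V} {σ : Representation k G W} (hρ : Irr ρ) (hσ : Irr σ)
    (hne : ρ.character ≠ σ.character) (T : V →ₗ[k] W) (hT : ∀ g, T ∘ₗ ρ g = σ g ∘ₗ T) : T = 0 := by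
  by_contra hT0
  have : ip ρ.character σ.character = 0 := by
    by_contra h
    exact hne (ip_ne_zero_eq (isIrrChar_of ρ hρ) (isIrrChar_of σ hσ) h)
  rw [ip_rep, Nat.cast_eq_zero] at this
  have hs := Module.finrank_zero_iff.1 this
  let T' : Representation.IntertwiningMap ρ σ := ⟨T, hT⟩
  have h0 : T' = 0 := Subsingleton.elim _ _
  exact hT0 (congrArg (fun f => f.toLinearMap) h0)

theorem zop_zero {ρ : Representation k G V} {σ : Representation k G W} (hρ : Irr ρ) (hσ : Irr σ)
    (hne : ρ.character ≠ σ.character) : zop σ ρ.character = 0 := by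
  ext u
  let b := Module.finBasis k V
  have htr : ∀ g, ρ.character g = ∑ i, b.coord i (ρ g (b i)) := by
    intro g
    unfold Representation.character
    rw [LinearMap.trace_eq_matrix_trace k b]
    simp [Matrix.trace, LinearMap.toMatrix_apply]
  let T : ∀ i, V →ₗ[k] W := fun i => ∑ g : G, σ g⁻¹ ∘ₗ ((b.coord i).smulRight u) ∘ₗ ρ g
  have hT : ∀ i, T i = 0 := by
    intro i
    apply hom_zero hρ hσ hne
    intro y
    ext x
    simp only [T, LinearMap.comp_apply, LinearMap.sum_apply, map_sum]
    rw [← Equiv.sum_comp (Equiv.mulRight y) (fun g => σ y (σ g⁻¹ _))]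
    refine Finset.sum_congr rfl fun g _ => ?_
    rw [← Module.End.mul_apply (σ y), ← map_mul]
    simp
  have : zop σ ρ.character u = ∑ i, T i (b i) := by
    simp only [zop, T, htr, LinearMap.sum_apply, LinearMap.smul_apply, LinearMap.comp_apply,
      Finset.sum_smul, LinearMap.smulRight_apply, map_smul]
    rw [Finset.sum_comm]
  rw [this]
  simp [hT]

theorem exists_sep {ρ : Representation k G V} (hρ : Irr ρ) :
    ∃ e : G → k, conv e ρ.character = ρ.character ∧
      ∀ u, IsIrrChar u → u ≠ ρ.character → conv e u = 0 := by
  set f := ρ.character with hf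
  have hfc : IsIrrChar f := isIrrChar_of ρ hρ
  have hG : (Fintype.card G : k) ≠ 0 := Nat.cast_ne_zero.2 Fintype.card_ne_zero
  have hinj : Function.Injective (zop ρ f) := by
    rcases irr_inj hρ (zop ρ f) (zop_comm ρ f hfc.isChar.conj) with h | h
    · exfalso
      have h1 := trace_zop ρ f 1
      rw [h, ← hf, conv_one _ _ hG] at h1
      simp only [zero_mul, map_zero] at h1
      exact (mul_ne_zero hG ((ip_ne_iff hfc hfc).2 rfl)) h1.symm
    · exact h
  let Z : (G → k) →ₗ[k] (V →ₗ[k] V) :=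
    { toFun := zop ρ
      map_add' := fun a b => by simp [zop, add_smul, Finset.sum_add_distrib]
      map_smul' := fun a b => by simp [zop, Finset.smul_sum, smul_smul] }
  let C := LinearMap.range Z
  have hC : ∀ x ∈ C, (LinearMap.mulLeft k (zop ρ f)) x ∈ C := by
    rintro _ ⟨b, rfl⟩
    exact ⟨conv b f, (zop_mul ρ f b).symm⟩
  let L : C →ₗ[k] C := (LinearMap.mulLeft k (zop ρ f)).restrict hC
  have hL : Function.Injective L := by
    rw [← LinearMap.ker_eq_bot, LinearMap.ker_eq_bot']
    rintro ⟨x, hx⟩ h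
    have h' : zop ρ f * x = 0 := congrArg Subtype.val h
    ext1
    ext v
    apply hinj
    rw [← Module.End.mul_apply, h']
    simp
  have hS := LinearMap.surjective_of_injective hL
  have h1C : (1 : V →ₗ[k] V) ∈ C := by
    refine ⟨Pi.single 1 1, ?_⟩
    show ∑ g : G, _ = _
    rw [Finset.sum_eq_single 1]
    · simp
    · intro b _ hb; simp [hb]
    · simp
  obtain ⟨⟨_, ⟨b, rfl⟩⟩, hb⟩ := hS ⟨1, h1C⟩
  have hb' : zop ρ f * zop ρ b = 1 := congrArg Subtype.val hb
  rw [zop_mul] at hb'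
  refine ⟨conv b f, ?_, ?_⟩
  · ext x
    rw [hf, ← trace_zop, ← hf, hb', one_mul]; rfl
  · intro u hu hne
    obtain ⟨W, _, _, _, σ, hW, rfl⟩ := hu.ex
    ext x
    rw [← trace_zop, ← zop_mul, zop_zero hρ hW hne.symm]
    simp

theorem irr_idem {f : G → k} (hf : IsIrrChar f) :
    ∃ q : ℚ, 0 < q ∧ conv ((q : k) • f) f = f := by
  obtain ⟨V, _, _, _, ρ, hV, rfl⟩ := hf.ex
  set f := ρ.character with hfd
  obtain ⟨e, he, he'⟩ := exists_sep hV
  have hG : (Fintype.card G : k) ≠ 0 := Nat.cast_ne_zero.2 Fintype.card_ne_zero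
  have hreg : conv e (fun g : G => if g = 1 then (Fintype.card G : k) else 0) =
      (Fintype.card G : k) • e := by
    ext x
    simp only [conv, Pi.smul_apply, smul_eq_mul]
    rw [Finset.sum_eq_single x]
    · simp [mul_comm]
    · intro b _ hb
      rw [if_neg, mul_zero]
      intro h; apply hb; exact inv_mul_eq_one.1 h
    · simp
  obtain ⟨s, hs, hs'⟩ := (IsChar.reg (k := k) (G := G)).decomp
  have hn : ∀ s : Multiset (G → k), (∀ u ∈ s, IsIrrChar u) → ∃ n : ℕ, conv e s.sum = (n : k) • f := by
    intro s
    induction s using Multiset.induction_on with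
    | empty => intro _; exact ⟨0, by simp [conv_zero_right]⟩
    | cons a s ih =>
      intro hs
      obtain ⟨n, hn⟩ := ih fun u hu => hs u (by simp [hu])
      rw [Multiset.sum_cons, conv_add_right, hn]
      by_cases ha : a = f
      · refine ⟨1 + n, ?_⟩
        rw [ha, he]; push_cast; rw [add_smul, one_smul]
      · exact ⟨n, by rw [he' a (hs a (by simp)) ha, zero_add]⟩
  obtain ⟨n, hn⟩ := hn s hs
  rw [← hs', hreg] at hn
  have hee : e = (((n : ℚ) / (Fintype.card G : ℚ) : ℚ) : k) • f := by
    push_cast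
    rw [div_eq_inv_mul, mul_smul, ← hn, smul_smul, inv_mul_cancel₀ hG, one_smul]
  refine ⟨(n : ℚ) / Fintype.card G, ?_, ?_⟩
  · have hn0 : n ≠ 0 := by
      rintro rfl
      have : e = 0 := by rw [hee]; simp
      rw [this, conv_zero_left] at he
      obtain ⟨m, hm, hm'⟩ := hf.one
      rw [hfd, ← he] at hm'
      simp only [Pi.zero_apply] at hm'
      exact hm.ne (by exact_mod_cast hm')
    have : 0 < Fintype.card G := Fintype.card_pos
    positivity
  · rw [← hee]; exact he

end
end Genotype

namespace Genotype

/-- cyclotomic field -/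
abbrev MM (N : ℕ) : Type := CyclotomicField N ℚ

instance MMcyc (N : ℕ) [NeZero N] : IsCyclotomicExtension {N} ℚ (MM N) := by
  have h := CyclotomicField.isCyclotomicExtension N ℚ
  have e : (DivisionRing.toRatAlgebra : Algebra ℚ (MM N)) = CyclotomicField.algebra N ℚ :=
    Subsingleton.elim _ _
  rw [e]
  exact h

/-- exponent of a Galois element -/
def pw (N : ℕ) [NeZero N] (σ : Gal(MM N/ℚ)) : ℕ :=
  (IsCyclotomicExtension.Rat.galEquivZMod N (MM N) σ).val.val

/-- embedding in the algebraic closure -/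
def iota (N : ℕ) (k : Type) [Field k] [CharZero k] : MM N →+* AlgebraicClosure k :=
  haveI : CharZero (AlgebraicClosure k) := charZero_of_injective_algebraMap
    (algebraMap k (AlgebraicClosure k)).injective
  (IsAlgClosed.lift (R := ℚ) (S := MM N) (M := AlgebraicClosure k)).toRingHom

section
variable (N : ℕ) [NeZero N]

theorem pw_root (σ : Gal(MM N/ℚ)) {x : MM N} (hx : x ^ N = 1) : σ x = x ^ pw N σ :=
  IsCyclotomicExtension.Rat.galEquivZMod_apply_of_pow_eq N (MM N) σ hx

theorem pow_congr {G : Type} [Group G] {g : G} (hg : g ^ N = 1) {a b : ℕ} (h : a ≡ b [MOD N]) :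
    g ^ a = g ^ b := by
  apply pow_eq_pow_iff_modEq.2
  exact h.of_dvd (orderOf_dvd_of_pow_eq_one hg)

theorem pw_mul (σ τ : Gal(MM N/ℚ)) {G : Type} [Group G] {g : G} (hg : g ^ N = 1) :
    g ^ pw N (σ * τ) = (g ^ pw N σ) ^ pw N τ := by
  rw [← pow_mul]
  apply pow_congr N hg
  unfold pw
  rw [map_mul, Units.val_mul, ZMod.val_mul]
  exact Nat.mod_modEq _ _

theorem pw_one {G : Type} [Group G] {g : G} (hg : g ^ N = 1) :
    g ^ pw N 1 = g := by
  conv_rhs => rw [← pow_one g]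
  apply pow_congr N hg
  unfold pw
  rw [map_one, Units.val_one, ZMod.val_one_eq_one_mod]
  exact Nat.mod_modEq _ _

theorem pw_inv (σ : Gal(MM N/ℚ)) {G : Type} [Group G] {g : G} (hg : g ^ N = 1) :
    (g ^ pw N σ) ^ pw N σ⁻¹ = g := by
  rw [← pw_mul N _ _ hg, mul_inv_cancel, pw_one N hg]

theorem pw_inv' (σ : Gal(MM N/ℚ)) {G : Type} [Group G] {g : G} (hg : g ^ N = 1) :
    (g ^ pw N σ⁻¹) ^ pw N σ = g := by
  rw [← pw_mul N _ _ hg, inv_mul_cancel, pw_one N hg]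

variable {k : Type} [Field k] [CharZero k]

theorem root_mem {z : AlgebraicClosure k} (hz : z ^ N = 1) : ∃ y : MM N, y ^ N = 1 ∧ iota N k y = z := by
  have h := IsCyclotomicExtension.zeta_spec N ℚ (MM N)
  have h2 := h.map_of_injective (iota N k).injective
  obtain ⟨i, _, hi⟩ := h2.eq_pow_of_pow_eq_one hz
  refine ⟨IsCyclotomicExtension.zeta N ℚ (MM N) ^ i, ?_, ?_⟩
  · rw [pow_right_comm, h.pow_eq_one, one_pow]
  · rw [map_pow, hi]

theorem eig_irr {K : Type} [Field K] [IsAlgClosed K] {G : Type} [Group G] {V : Type}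
    [AddCommGroup V] [Module K V]
    [FiniteDimensional K V] (ρ : Representation K G V) (h : Irr ρ) (g : G) (hg : g ^ N = 1)
    (hc : ∀ x, x * g = g * x) :
    ∃ z : K, z ^ N = 1 ∧ ∀ c, ρ.character (g ^ c) = Module.finrank K V • z ^ c := by
  haveI := h.1
  obtain ⟨z, hz⟩ := Module.End.exists_eigenvalue (ρ g)
  have hE : Module.End.eigenspace (ρ g) z = ⊤ := by
    rcases h.2 (Module.End.eigenspace (ρ g) z) (by
      intro y x hx
      rw [Module.End.mem_eigenspace_iff] at hx ⊢
      rw [← Module.End.mul_apply, ← map_mul, ← hc, map_mul, Module.End.mul_apply, hx, map_smul]) with h | h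
    · exact absurd h hz
    · exact h
  have hs : ρ g = z • 1 := by
    ext x
    have : x ∈ Module.End.eigenspace (ρ g) z := hE ▸ Submodule.mem_top
    simpa [Module.End.mem_eigenspace_iff] using this
  have hp : ∀ c, ρ (g ^ c) = z ^ c • 1 := by
    intro c; rw [map_pow, hs, smul_pow, one_pow]
  refine ⟨z, ?_, ?_⟩
  · have h1 := hp N
    rw [hg, map_one] at h1
    obtain ⟨x, hx⟩ := exists_ne (0 : V)
    have h2 := LinearMap.congr_fun h1 x
    simp only [Module.End.one_apply, LinearMap.smul_apply] at h2
    have h3 : (z ^ N - 1) • x = 0 := by rw [sub_smul, one_smul, ← h2, sub_self]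
    rcases smul_eq_zero.1 h3 with h | h
    · exact sub_eq_zero.1 h
    · exact absurd h hx
  · intro c
    unfold Representation.character
    rw [hp, map_smul]
    simp [mul_comm]

theorem eig {G : Type} [Group G] [Fintype G] {f : G → AlgebraicClosure k} (hf : IsChar f) (g : G)
    (hg : g ^ N = 1) : ∃ s : Multiset (MM N), (∀ z ∈ s, z ^ N = 1) ∧
      ∀ c : ℕ, f (g ^ c) = iota N k (s.map (· ^ c)).sum := by
  haveI : CharZero (AlgebraicClosure k) := charZero_of_injective_algebraMap
    (algebraMap k (AlgebraicClosure k)).injective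
  haveI : Fintype (Subgroup.zpowers g) := Fintype.ofFinite _
  obtain ⟨s, hs, hs'⟩ := (hf.res (Subgroup.zpowers g)).decomp
  let γ : Subgroup.zpowers g := ⟨g, Subgroup.mem_zpowers g⟩
  have hγ : ∀ c, f (g ^ c) = resChar (Subgroup.zpowers g) f (γ ^ c) := fun c => rfl
  simp only [hγ, hs']
  clear hs' hγ
  induction s using Multiset.induction_on with
  | empty => exact ⟨0, by simp, by simp⟩
  | cons a s ih =>
    obtain ⟨t, ht, ht'⟩ := ih fun u hu => hs u (by simp [hu])
    obtain ⟨V, _, _, _, ρ, hV, ha⟩ := (hs a (by simp)).ex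
    obtain ⟨z, hz, hz'⟩ := eig_irr N ρ hV γ (Subtype.ext hg) (fun x => by
      exact mul_comm' x γ)
    obtain ⟨y, hy, rfl⟩ := root_mem N hz
    refine ⟨Multiset.replicate (Module.finrank (AlgebraicClosure k) V) y + t, ?_, ?_⟩
    · intro w hw
      rcases Multiset.mem_add.1 hw with h | h
      · rw [Multiset.eq_of_mem_replicate h, hy]
      · exact ht w h
    · intro c
      rw [Multiset.sum_cons, Pi.add_apply, ht', ha, hz']
      simp

/-- functions with cyclotomic values compatible with powers -/
def Good {G : Type} [Group G] (f : G → k) : Prop :=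
  ∃ y : G → MM N, (∀ g, iota N k (y g) = algebraMap k (AlgebraicClosure k) (f g)) ∧
    ∀ (σ : Gal(MM N/ℚ)) (g : G), σ (y g) = y (g ^ pw N σ)

/-- twist -/
def tw {G : Type} [Group G] (σ : Gal(MM N/ℚ)) (f : G → k) : G → k := fun g => f (g ^ pw N σ)

variable {G : Type} [Group G]

theorem IsChar.good [Fintype G] (hN : ∀ g : G, g ^ N = 1) {f : G → k} (hf : IsChar f) : Good N f := by
  choose s hs hs' using fun g => eig N (hf.map (algebraMap k (AlgebraicClosure k))) g (hN g)
  refine ⟨fun g => ((s g).map (· ^ 1)).sum, fun g => ?_, fun σ g => ?_⟩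
  · rw [← hs', pow_one]
  · apply (iota N k).injective
    rw [← hs', pow_one, hs', map_multiset_sum, Multiset.map_map]
    congr 2
    refine Multiset.map_congr rfl fun z hz => ?_
    simp [pw_root N σ (hs g z hz)]

theorem Good.smul {f : G → k} (hf : Good N f) (q : ℚ) : Good N ((q : k) • f) := by
  obtain ⟨y, h1, h2⟩ := hf
  refine ⟨fun g => q * y g, fun g => by simp [h1], fun σ g => by simp [h2]⟩

theorem Good.zero : Good N (0 : G → k) := ⟨0, by simp, by simp⟩

theorem Good.add {f h : G → k} (hf : Good N f) (hh : Good N h) : Good N (f + h) := by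
  obtain ⟨y, h1, h2⟩ := hf
  obtain ⟨z, h3, h4⟩ := hh
  exact ⟨y + z, fun g => by simp [h1, h3], fun σ g => by simp [h2, h4]⟩

theorem Good.fsum {ι : Type} (s : Finset ι) (F : ι → G → k) (h : ∀ i ∈ s, Good N (F i)) :
    Good N (∑ i ∈ s, F i) :=
  Finset.sum_induction _ (Good N) (fun _ _ => Good.add N) (Good.zero N) h

theorem Good.tw {f : G → k} (hf : Good N f) (τ : Gal(MM N/ℚ)) : Good N (tw N τ f) := by
  obtain ⟨y, h1, h2⟩ := hf
  exact ⟨Genotype.tw N τ y, fun g => h1 _, fun σ g => by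
    simp only [Genotype.tw, h2]; rw [pow_right_comm]⟩

theorem Good.rat {f : G → k} (hf : Good N f) (h : ∀ σ, Genotype.tw N σ f = f) :
    ∃ f₀ : G → ℚ, f = fun g => ((f₀ g : ℚ) : k) := by
  obtain ⟨y, h1, h2⟩ := hf
  haveI : IsGalois ℚ (MM N) := IsCyclotomicExtension.isGalois {N} ℚ (MM N)
  haveI : FiniteDimensional ℚ (MM N) := IsCyclotomicExtension.finiteDimensional {N} ℚ (MM N)
  have : ∀ g, ∃ q : ℚ, algebraMap ℚ (MM N) q = y g := by
    intro g
    have := (IsGalois.mem_bot_iff_fixed (F := ℚ) (y g)).2 (by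
      intro σ
      rw [h2]
      apply (iota N k).injective
      rw [h1, h1]
      exact congrArg _ (congrFun (h σ) g))
    exact IntermediateField.mem_bot.1 this
  choose f₀ hf₀ using this
  refine ⟨f₀, ?_⟩
  ext g
  apply (algebraMap k (AlgebraicClosure k)).injective
  rw [← h1, ← hf₀]
  simp

variable [Fintype G]

theorem conv_tw {f h r : G → k} (hf : Good N f) (hh : Good N h) (hr : Good N r)
    (σ : Gal(MM N/ℚ)) (he : conv f h = r) : conv (tw N σ f) (tw N σ h) = tw N σ r := by
  obtain ⟨y, h1, h2⟩ := hf
  obtain ⟨z, h3, h4⟩ := hh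
  obtain ⟨w, h5, h6⟩ := hr
  have hy : conv y z = w := by
    ext x
    apply (iota N k).injective
    rw [h5, ← he]
    have a := congrFun (conv_map (iota N k) y z) x
    have b := congrFun (conv_map (algebraMap k (AlgebraicClosure k)) f h) x
    rw [← a, ← b]
    simp only [h1, h3]
  ext x
  apply (algebraMap k (AlgebraicClosure k)).injective
  have a := congrFun (conv_map ((iota N k).comp (σ : MM N →+* MM N)) y z) x
  have b := congrFun (conv_map (algebraMap k (AlgebraicClosure k)) (tw N σ f) (tw N σ h)) x
  simp only [hy] at a b
  rw [← b]
  simp only [tw] at a b ⊢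
  rw [← h5, ← h6]
  refine Eq.trans ?_ a
  congr 1
  · ext g
    rw [← h1, ← h2]; rfl
  · ext g
    rw [← h3, ← h4]; rfl

theorem tw_tw (hN : ∀ g : G, g ^ N = 1) (σ τ : Gal(MM N/ℚ)) (f : G → k) :
    tw N σ (tw N τ f) = tw N (σ * τ) f := by
  ext g
  simp only [tw, pw_mul N σ τ (hN g)]

theorem tw_one (hN : ∀ g : G, g ^ N = 1) (f : G → k) : tw N 1 f = f := by
  ext g
  simp only [tw, pw_one N (hN g)]

theorem tw_conj (σ : Gal(MM N/ℚ)) {f : G → k} (hf : ∀ x g, f (x * g * x⁻¹) = f g) (x g : G) :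
    tw N σ f (x * g * x⁻¹) = tw N σ f g := by
  simp only [tw, conj_pow, hf]

theorem tw_at_one (σ : Gal(MM N/ℚ)) (f : G → k) : tw N σ f 1 = f 1 := by
  simp [tw]

theorem tw_smul (σ : Gal(MM N/ℚ)) (c : k) (f : G → k) : tw N σ (c • f) = c • tw N σ f := rfl

/-- an idempotent attached to an irreducible character -/
structure Idem (f e : G → k) : Prop where
  irr : IsIrrChar f
  ex : ∃ q : ℚ, 0 < q ∧ e = (q : k) • f
  ff : conv e f = f

theorem IsIrrChar.idem {f : G → k} (hf : IsIrrChar f) : ∃ e, Idem f e := by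
  obtain ⟨q, hq, h⟩ := irr_idem hf
  exact ⟨_, hf, ⟨q, hq, rfl⟩, h⟩

theorem Idem.conj {f e : G → k} (h : Idem f e) (x g : G) : e (x * g * x⁻¹) = e g := by
  obtain ⟨q, hq, rfl⟩ := h.ex
  simp [h.irr.isChar.conj x g]

theorem Idem.ee {f e : G → k} (h : Idem f e) : conv e e = e := by
  obtain ⟨q, hq, he⟩ := h.ex
  conv_lhs => rw [he, conv_smul_right, ← he, h.ff]
  exact he.symm

theorem Idem.one {f e : G → k} (h : Idem f e) : e 1 ≠ 0 := by
  obtain ⟨q, hq, rfl⟩ := h.ex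
  obtain ⟨n, hn, hn'⟩ := h.irr.one
  simp [hn', hn.ne', hq.ne']

theorem Idem.good (hN : ∀ g : G, g ^ N = 1) {f e : G → k} (h : Idem f e) : Good N e := by
  obtain ⟨q, hq, rfl⟩ := h.ex
  exact (h.irr.isChar.good N hN).smul N q

theorem Idem.twee (hN : ∀ g : G, g ^ N = 1) {f e : G → k} (h : Idem f e) (σ : Gal(MM N/ℚ)) :
    conv (tw N σ e) (tw N σ e) = tw N σ e :=
  conv_tw N (h.good N hN) (h.good N hN) (h.good N hN) σ h.ee

theorem Idem.act {f e v : G → k} (h : Idem f e) (hv : ∀ x g, v (x * g * x⁻¹) = v g)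
    (hvv : conv v v = v) : conv v e = e ∨ conv v e = 0 := by
  obtain ⟨q, hq, he⟩ := h.ex
  rcases idem_irr hv hvv h.irr with h' | h'
  · left; rw [he, conv_smul_right, h']
  · right; rw [he, conv_smul_right, h', smul_zero]

theorem Idem.main (hN : ∀ g : G, g ^ N = 1) {f e f' e' : G → k} (h : Idem f e) (h' : Idem f' e')
    (σ : Gal(MM N/ℚ)) (hne : conv (tw N σ e) e' ≠ 0) : e' = tw N σ e := by
  have h1 : conv (tw N σ e) e' = e' :=
    (h'.act (tw_conj N σ h.conj) (h.twee N hN σ)).resolve_right hne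
  have h2 := conv_tw N ((h.good N hN).tw N σ) (h'.good N hN) (h'.good N hN) σ⁻¹ h1
  rw [tw_tw N hN, inv_mul_cancel, tw_one N hN,
    conv_comm _ _ h.conj] at h2
  have h3 : tw N σ⁻¹ e' = e := by
    rcases h.act (tw_conj N σ⁻¹ h'.conj) (h'.twee N hN σ⁻¹) with h4 | h4
    · rw [← h2, h4]
    · exfalso
      rw [h4] at h2
      have := congrFun h2 1
      rw [tw_at_one] at this
      exact h'.one this.symm
  rw [← h3, tw_tw N hN, mul_inv_cancel, tw_one N hN]

/-- P2 -/
theorem P2 (hN : ∀ g : G, g ^ N = 1) {f : G → k} (hf : IsIrrChar f) (σ : Gal(MM N/ℚ))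
    (h : ip f (tw N σ f) ≠ 0) : tw N σ f = f := by
  obtain ⟨e, he⟩ := hf.idem
  obtain ⟨q, hq, hqe⟩ := he.ex
  have hG : (Fintype.card G : k) ≠ 0 := Nat.cast_ne_zero.2 Fintype.card_ne_zero
  have hq' : (q : k) ≠ 0 := by exact_mod_cast hq.ne'
  have := he.main N hN he σ (by
    intro h0
    have := congrFun h0 1
    rw [conv_one _ _ hG, hqe, tw_smul, ip_smul_left, ip_smul_right, ip_comm] at this
    simp only [Pi.zero_apply, mul_eq_zero] at this
    tauto)
  rw [hqe, tw_smul] at this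
  exact (smul_right_injective _ hq' this).symm

theorem idem_char {v : G → k} (hv : ∀ x g, v (x * g * x⁻¹) = v g) (hvv : conv v v = v)
    {f : G → k} (hf : IsChar f) : ∃ n m : ℕ, n ≤ m ∧ conv v f 1 = n ∧ f 1 = m := by
  obtain ⟨s, hs, rfl⟩ := hf.decomp
  clear hf
  induction s using Multiset.induction_on with
  | empty => exact ⟨0, 0, le_rfl, by simp [conv_zero_right]⟩
  | cons a s ih =>
    obtain ⟨n, m, h, h1, h2⟩ := ih fun u hu => hs u (by simp [hu])
    obtain ⟨l, hl⟩ := (hs a (by simp)).isChar.one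
    rw [Multiset.sum_cons, conv_add_right]
    rcases idem_irr hv hvv (hs a (by simp)) with ha | ha
    · exact ⟨l + n, l + m, by omega, by simp [ha, hl, h1], by simp [hl, h2]⟩
    · exact ⟨n, l + m, by omega, by simp [ha, h1], by simp [hl, h2]⟩

theorem idem_sub {v : G → k} (hv : ∀ x g, v (x * g * x⁻¹) = v g) (hvv : conv v v = v)
    {f c : G → k} (hf : IsIrrChar f) (hc : CharOccurs f c) :
    (conv v c = c → conv v f = f) ∧ (conv v c = 0 → conv v f = 0) := by
  obtain ⟨w, hw, rfl⟩ := occurs_iff.1 hc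
  obtain ⟨n, m, h, h1, h2⟩ := idem_char hv hvv hw
  obtain ⟨l, hl, hl'⟩ := hf.one
  rw [conv_add_right]
  constructor
  · intro hh
    refine (idem_irr hv hvv hf).resolve_right fun h0 => ?_
    have := congrFun hh 1
    simp only [h0, zero_add, h1, Pi.add_apply, hl', h2] at this
    rw [Pi.zero_apply, zero_add] at this
    norm_cast at this; omega
  · intro hh
    refine (idem_irr hv hvv hf).resolve_left fun h0 => ?_
    have := congrFun hh 1
    simp only [h0, h1, Pi.add_apply, hl', Pi.zero_apply] at this
    norm_cast at this; omega

theorem P1 (hN : ∀ g : G, g ^ N = 1) {X : G → ℚ} (hX : IsIrrChar X) {f f' : G → k}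
    (hf : IsIrrChar f) (hf' : IsIrrChar f')
    (ho : CharOccurs f (fun g => algebraMap ℚ k (X g)))
    (ho' : CharOccurs f' (fun g => algebraMap ℚ k (X g))) :
    ∃ (σ : Gal(MM N/ℚ)) (r : ℚ), 0 < r ∧ f' = (r : k) • tw N σ f := by
  obtain ⟨e, he⟩ := hf.idem
  obtain ⟨e', he'⟩ := hf'.idem
  haveI : FiniteDimensional ℚ (MM N) := IsCyclotomicExtension.finiteDimensional {N} ℚ (MM N)
  haveI : Fintype Gal(MM N/ℚ) := Fintype.ofFinite _
  let O : Finset (G → k) := Finset.univ.image fun σ => tw N σ e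
  let ε : G → k := ∑ u ∈ O, u
  have hO : ∀ u, u ∈ O ↔ ∃ σ, tw N σ e = u := by intro u; simp [O]
  have horth : ∀ u ∈ O, ∀ u' ∈ O, u ≠ u' → conv u u' = 0 := by
    intro u hu u' hu' hne
    obtain ⟨σ, rfl⟩ := (hO u).1 hu
    obtain ⟨τ, rfl⟩ := (hO u').1 hu'
    have h1 : conv (tw N (τ⁻¹ * σ) e) e = 0 := by
      by_contra h
      have := he.main N hN he _ h
      apply hne
      conv_rhs => rw [this, tw_tw N hN, mul_inv_cancel_left]
    have h2 := conv_tw N ((he.good N hN).tw N _) (he.good N hN) (Good.zero N) τ h1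
    rw [tw_tw N hN, mul_inv_cancel_left] at h2
    exact h2
  have hconj : ∀ x g, ε (x * g * x⁻¹) = ε g := by
    intro x g
    simp only [ε, Finset.sum_apply]
    refine Finset.sum_congr rfl fun u hu => ?_
    obtain ⟨σ, rfl⟩ := (hO u).1 hu
    exact tw_conj N σ he.conj x g
  have hεε : conv ε ε = ε := by
    simp only [ε]
    rw [conv_fsum_left]
    refine Finset.sum_congr rfl fun u hu => ?_
    rw [conv_fsum_right, Finset.sum_eq_single u]
    · obtain ⟨σ, rfl⟩ := (hO u).1 hu
      exact he.twee N hN σ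
    · intro b hb hne
      exact horth u hu b hb hne.symm
    · intro h; exact absurd hu h
  have hεe : conv ε e = e := by
    have heO : e ∈ O := (hO e).2 ⟨1, tw_one N hN e⟩
    simp only [ε]
    rw [conv_fsum_left, Finset.sum_eq_single e]
    · exact he.ee
    · intro b hb hne
      exact horth b hb e heO hne
    · intro h; exact absurd heO h
  have hgood : Good N ε := by
    apply Good.fsum
    intro u hu
    obtain ⟨σ, rfl⟩ := (hO u).1 hu
    exact (he.good N hN).tw N σ
  have htw : ∀ σ, tw N σ ε = ε := by
    intro σ
    have h1 : tw N σ ε = ∑ u ∈ O, tw N σ u := by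
      ext g; simp [tw, ε]
    rw [h1]
    refine Finset.sum_nbij' (tw N σ) (tw N σ⁻¹) ?_ ?_ ?_ ?_ ?_
    · intro u hu
      obtain ⟨τ, rfl⟩ := (hO u).1 hu
      exact (hO _).2 ⟨σ * τ, (tw_tw N hN _ _ _).symm⟩
    · intro u hu
      obtain ⟨τ, rfl⟩ := (hO u).1 hu
      exact (hO _).2 ⟨σ⁻¹ * τ, (tw_tw N hN _ _ _).symm⟩
    · intro u hu
      rw [tw_tw N hN, inv_mul_cancel, tw_one N hN]
    · intro u hu
      rw [tw_tw N hN, mul_inv_cancel, tw_one N hN]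
    · intro u hu; rfl
  obtain ⟨ε₀, hε₀⟩ := hgood.rat N htw
  have hc0 : ∀ x g, ε₀ (x * g * x⁻¹) = ε₀ g := by
    intro x g
    have := hconj x g
    rw [hε₀] at this
    simpa using this
  have hmap : ∀ h : G → ℚ, conv ε (fun g => algebraMap ℚ k (h g)) =
      fun g => algebraMap ℚ k (conv ε₀ h g) := by
    intro h
    rw [← conv_map, hε₀]; rfl
  have hee0 : conv ε₀ ε₀ = ε₀ := by
    ext g
    apply (algebraMap ℚ k).injective
    have h1 := congrFun (hmap ε₀) g
    rw [← h1]
    have h2 : (fun g => algebraMap ℚ k (ε₀ g)) = ε := by rw [hε₀]; rfl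
    rw [h2, hεε, ← h2]
  have hεf : conv ε f ≠ 0 := by
    intro h0
    obtain ⟨q, hq, hqe⟩ := he.ex
    rw [hqe, conv_smul_right, h0, smul_zero, ← hqe] at hεe
    apply he.one
    rw [← hεe]; rfl
  have hεf' : conv ε f' = f' := by
    rcases idem_irr hc0 hee0 hX with h | h
    · refine (idem_sub hconj hεε hf' ho').1 ?_
      rw [hmap, h]
    · exfalso
      apply hεf
      refine (idem_sub hconj hεε hf ho).2 ?_
      rw [hmap, h]
      ext g; simp
  obtain ⟨q', hq', hqe'⟩ := he'.ex
  obtain ⟨q, hq, hqe⟩ := he.ex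
  have : ∃ u ∈ O, conv u e' ≠ 0 := by
    by_contra! hcon
    have h1 : conv ε e' = 0 := by
      simp only [ε]
      rw [conv_fsum_left]
      exact Finset.sum_eq_zero hcon
    have h2 : conv ε e' = e' := by rw [hqe', conv_smul_right, hεf']
    apply he'.one
    rw [← h2, h1]; rfl
  obtain ⟨u, hu, hne⟩ := this
  obtain ⟨σ, rfl⟩ := (hO u).1 hu
  have h1 := he.main N hN he' σ hne
  have hq0 : (q' : k) ≠ 0 := by exact_mod_cast hq'.ne'
  refine ⟨σ, q'⁻¹ * q, by positivity, ?_⟩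
  rw [hqe, hqe', tw_smul] at h1
  push_cast
  rw [mul_smul, ← h1, smul_smul, inv_mul_cancel₀ hq0, one_smul]

theorem tw_galois {f : G → k} (hf : Good N f) (σ : Gal(MM N/ℚ)) :
    IsGaloisConj f (tw N σ f) := by
  obtain ⟨y, h1, h2⟩ := hf
  haveI : IsGalois ℚ (MM N) := IsCyclotomicExtension.isGalois {N} ℚ (MM N)
  have key : ∀ h : G → k, (∀ g, ∃ z, iota N k z = algebraMap k (AlgebraicClosure k) (h g)) →
      ∃ i : charField h →+* MM N, ∀ x, iota N k (i x) = algebraMap k (AlgebraicClosure k) (x : k) := by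
    intro h hh
    have hle : charField h ≤ (iota N k).fieldRange.comap (algebraMap k (AlgebraicClosure k)) := by
      apply Subfield.closure_le.2
      rintro _ ⟨g, rfl⟩
      exact hh g
    choose F hF using fun x : charField h => (hle x.2 : _ ∈ (iota N k).fieldRange)
    have hF' : ∀ x, iota N k (F x) = algebraMap k (AlgebraicClosure k) (x : k) := hF
    refine ⟨{ toFun := F, map_one' := ?_, map_mul' := ?_, map_zero' := ?_, map_add' := ?_ }, hF'⟩
    · apply (iota N k).injective; rw [hF']; simp
    · intro a b; apply (iota N k).injective; simp [hF']
    · apply (iota N k).injective; rw [hF']; simp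
    · intro a b; apply (iota N k).injective; simp [hF']
  obtain ⟨i, hi⟩ := key f fun g => ⟨_, h1 g⟩
  obtain ⟨j, hj⟩ := key (tw N σ f) fun g => ⟨_, h1 _⟩
  refine ⟨MM N, inferInstance, inferInstance, inferInstance, i, j, σ.toRingEquiv, fun g => ?_⟩
  have e1 : i ⟨f g, mem_charField f g⟩ = y g := by
    apply (iota N k).injective; rw [hi, h1]
  have e2 : j ⟨tw N σ f g, mem_charField _ g⟩ = y (g ^ pw N σ) := by
    apply (iota N k).injective; rw [hj, h1]; rfl
  rw [e1, e2, ← h2]; rfl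

end
end Genotype

namespace Genotype

/-- scalar extension of a rational function -/
abbrev bc (k : Type) [Field k] [CharZero k] {G : Type} (X : G → ℚ) : G → k :=
  fun g => algebraMap ℚ k (X g)

section
variable {k : Type} [Field k] [CharZero k] {G : Type} [Group G] [Fintype G]

theorem ip_bc (X Y : G → ℚ) : ip (bc k X) (bc k Y) = algebraMap ℚ k (ip X Y) := ip_map _ X Y

theorem nat_add_ne {a b : k} (ha : ∃ n : ℕ, a = n) (hb : ∃ n : ℕ, b = n) (h : a ≠ 0) :
    a + b ≠ 0 := by
  obtain ⟨n, rfl⟩ := ha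
  obtain ⟨m, rfl⟩ := hb
  norm_cast at h ⊢
  omega

theorem U1 {X Y : G → ℚ} (hX : IsIrrChar X) (hY : IsIrrChar Y) {f : G → k} (hf : IsIrrChar f)
    (h1 : CharOccurs f (bc k X)) (h2 : CharOccurs f (bc k Y)) : X = Y := by
  apply ip_ne_zero_eq hX hY
  intro h0
  have h := ip_bc (k := k) X Y
  rw [h0, map_zero] at h
  obtain ⟨w, hw, e⟩ := occurs_iff.1 h1
  have hYc : IsChar (bc k Y) := hY.isChar.map _
  rw [e, ip_add_left] at h
  exact nat_add_ne (ip_nat hf.isChar hYc) (ip_nat hw hYc) (ip_ne_of_occurs hf h2) h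

theorem exists_of_sum {f : G → k} {s : Multiset (G → k)} (h : ip f s.sum ≠ 0) :
    ∃ u ∈ s, ip f u ≠ 0 := by
  by_contra! hc
  apply h
  rw [ip_sum_right]
  apply Multiset.sum_eq_zero
  intro x hx
  obtain ⟨u, hu, rfl⟩ := Multiset.mem_map.1 hx
  exact hc u hu

theorem bc_sum (s : Multiset (G → ℚ)) : bc k s.sum = (s.map (bc k)).sum := by
  induction s using Multiset.induction_on with
  | empty => ext g; simp [bc]
  | cons a s ih => rw [Multiset.sum_cons, Multiset.map_cons, Multiset.sum_cons, ← ih]; ext g; simp [bc]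

theorem U2 {f : G → k} (hf : IsIrrChar f) : ∃ X : G → ℚ, IsIrrChar X ∧ CharOccurs f (bc k X) := by
  obtain ⟨s, hs, hs'⟩ := (IsChar.reg (k := ℚ) (G := G)).decomp
  have hG : (Fintype.card G : k) ≠ 0 := Nat.cast_ne_zero.2 Fintype.card_ne_zero
  have h1 : ip f (bc k s.sum) = f 1 := by
    rw [← hs']
    simp only [ip, bc]
    rw [Finset.sum_eq_single 1]
    · simp; field_simp
    · intro b _ hb; simp [hb]
    · simp
  have h2 : ip f (bc k s.sum) ≠ 0 := by
    obtain ⟨n, hn, hn'⟩ := hf.one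
    rw [h1, hn']; exact_mod_cast hn.ne'
  rw [bc_sum] at h2
  obtain ⟨u, hu, hne⟩ := exists_of_sum h2
  obtain ⟨X, hX, rfl⟩ := Multiset.mem_map.1 hu
  exact ⟨X, hs X hX, occurs_of_ip hf ((hs X hX).isChar.map _) hne⟩

theorem G1 {f f' : G → k} (hf : IsIrrChar f) (hf' : IsIrrChar f') (hc : IsGaloisConj f f')
    {X : G → ℚ} (hX : IsChar X) (ho : CharOccurs f (bc k X)) : CharOccurs f' (bc k X) := by
  obtain ⟨M, _, _, _, i, j, α, h⟩ := hc
  apply occurs_of_ip hf' (hX.map _)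
  intro h0
  apply ip_ne_of_occurs hf ho
  have key : ∀ (u : G → k), ip u (bc k X) = (charField u).subtype
      (ip (fun g => (⟨u g, mem_charField u g⟩ : charField u)) (fun g => ((X g : ℚ) : charField u))) := by
    intro u
    rw [← ip_map]
    congr 1
    try (ext g; simp [bc])
  rw [key] at h0 ⊢
  rw [map_eq_zero_iff _ (charField f').subtype.injective] at h0
  have h1 := congrArg j h0
  rw [map_zero, ← ip_map] at h1
  simp only [← h] at h1
  have h2 : α (i (ip (fun g => (⟨f g, mem_charField f g⟩ : charField f))
      (fun g => ((X g : ℚ) : charField f)))) = 0 := by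
    have := ip_map ((α : M →+* M).comp i) (fun g => (⟨f g, mem_charField f g⟩ : charField f))
      (fun g => ((X g : ℚ) : charField f))
    rw [RingHom.comp_apply] at this
    refine this.symm.trans ?_
    rw [← h1]
    congr 1
    ext g; simp
  rw [map_eq_zero_iff _ α.injective, map_eq_zero_iff _ i.injective] at h2
  rw [h2, map_zero]

theorem ip_tw (N : ℕ) [NeZero N] (hN : ∀ g : G, g ^ N = 1) (σ : Gal(MM N/ℚ)) (f : G → k) :
    ip (tw N σ f) (tw N σ f) = ip f f := by
  unfold ip
  congr 1
  let E : G ≃ G := ⟨fun g => g ^ pw N σ, fun g => g ^ pw N σ⁻¹, fun g => pw_inv N σ (hN g),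
    fun g => pw_inv' N σ (hN g)⟩
  rw [← Equiv.sum_comp E (fun g => f g⁻¹ * f g)]
  refine Finset.sum_congr rfl fun g _ => ?_
  simp [tw, E]

theorem decomp_ne {f : G → k} (hf : IsChar f) (h : f ≠ 0) : ∃ u, IsIrrChar u ∧ CharOccurs u f := by
  obtain ⟨s, hs, rfl⟩ := hf.decomp
  rcases s.empty_or_exists_mem with rfl | ⟨u, hu⟩
  · exact absurd rfl h
  · exact ⟨u, hs u hu, occurs_of_mem hs hu⟩

variable (H : Subgroup G) [Fintype H]

theorem ind_ne {f : H → k} (hf : IsIrrChar f) : indChar H f ≠ 0 := by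
  intro h
  have h1 := congrFun h 1
  rw [indChar_eq] at h1
  obtain ⟨n, hn, hn'⟩ := hf.one
  have h2 : ∀ x : G, ext0 H f (x⁻¹ * 1 * x) = n := by
    intro x
    have : x⁻¹ * 1 * x = ((1 : H) : G) := by simp
    rw [this]
    simp [ext0, ← hn']
    rfl
  simp only [h2] at h1
  simp [hn.ne'] at h1

theorem frob' (f : H → k) {c : G → k} (hc : IsChar c) :
    ip f (resChar H c) = ip (indChar H f) c := (frob H f c hc.conj).symm

theorem occ_res {f : H → k} (hf : IsIrrChar f) {u : G → k} (hu : IsIrrChar u)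
    (ho : CharOccurs u (indChar H f)) : CharOccurs f (resChar H u) := by
  apply occurs_of_ip hf (hu.isChar.res H)
  rw [frob' H f hu.isChar, ip_comm]
  exact ip_ne_of_occurs hu ho

theorem ri_irr {f : H → k} (hf : IsIrrChar f) :
    ∃ Z, IsChar Z ∧ resChar H (indChar H f) = f + Z := by
  obtain ⟨u, hu, ho⟩ := decomp_ne (hf.isChar.ind H) (ind_ne H hf)
  obtain ⟨w, hw, e⟩ := occurs_iff.1 ho
  obtain ⟨z, hz, e'⟩ := occurs_iff.1 (occ_res H hf hu ho)
  refine ⟨z + resChar H w, hz.add (hw.res H), ?_⟩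
  rw [e, resChar_add, e', add_assoc]

theorem ri {f : H → k} (hf : IsChar f) :
    ∃ Z, IsChar Z ∧ resChar H (indChar H f) = f + Z := by
  obtain ⟨s, hs, rfl⟩ := hf.decomp
  clear hf
  induction s using Multiset.induction_on with
  | empty => exact ⟨0, IsChar.zero, by simp [indChar_zero]; rfl⟩
  | cons a s ih =>
    obtain ⟨Z, hZ, e⟩ := ih fun u hu => hs u (by simp [hu])
    obtain ⟨Z', hZ', e'⟩ := ri_irr H (hs a (by simp))
    refine ⟨Z' + Z, hZ'.add hZ, ?_⟩
    rw [Multiset.sum_cons, indChar_add, resChar_add, e, e']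
    abel

/-- the rational tightness condition -/
def TT (X : H → ℚ) : Prop := ip X (resChar H (indChar H X)) = ip X X

theorem ind_bc (X : H → ℚ) : indChar H (bc k X) = bc k (indChar H X) := indChar_map _ H X

theorem T1 {X : H → ℚ} (hX : IsIrrChar X) (hT : TT H X) {f f' : H → k} (hf : IsIrrChar f)
    (hf' : IsIrrChar f') (ho : CharOccurs f (bc k X)) (ho' : CharOccurs f' (bc k X)) :
    ip f (resChar H (indChar H f')) = ip f f' := by
  obtain ⟨Z, hZ, eZ⟩ := ri H hX.isChar
  have hZ0 : ip X Z = 0 := by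
    unfold TT at hT
    rw [eZ, ip_add_right] at hT
    linarith
  obtain ⟨R, hR, eR⟩ := occurs_iff.1 ho'
  obtain ⟨R', hR', eR'⟩ := occurs_iff.1 ho
  obtain ⟨Z1, hZ1, eZ1⟩ := ri H hf'.isChar
  obtain ⟨Z2, hZ2, eZ2⟩ := ri H hR
  have e1 : resChar H (indChar H (bc k X)) = bc k X + bc k Z := by
    rw [ind_bc]
    ext h
    have := congrFun eZ h
    simp only [resChar, bc, Pi.add_apply] at this ⊢
    rw [this, map_add]
  have e2 : bc k Z = Z1 + Z2 := by
    rw [eR, indChar_add, resChar_add, eZ1, eZ2] at e1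
    have : f' + R + bc k Z = f' + R + (Z1 + Z2) := by rw [← e1]; abel
    exact add_left_cancel this
  have e3 : ip (bc k X) (bc k Z) = 0 := by rw [ip_bc, hZ0, map_zero]
  have hZk : IsChar (bc k Z) := hZ.map _
  rw [eR', ip_add_left] at e3
  have e4 : ip f Z1 = 0 := by
    by_contra hne
    refine nat_add_ne (ip_nat hf.isChar hZk) (ip_nat hR' hZk) ?_ e3
    rw [e2, ip_add_right]
    exact nat_add_ne (ip_nat hf.isChar hZ1) (ip_nat hf.isChar hZ2) hne
  rw [eZ1, ip_add_right, e4, add_zero]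

theorem T2 {f : H → k} (hf : IsIrrChar f) (h : ip f (resChar H (indChar H f)) = ip f f) :
    IsIrrChar (indChar H f) := by
  obtain ⟨u, hu, ho⟩ := decomp_ne (hf.isChar.ind H) (ind_ne H hf)
  obtain ⟨w, hw, e⟩ := occurs_iff.1 ho
  by_cases hw0 : w = 0
  · rw [e, hw0, add_zero]; exact hu
  exfalso
  obtain ⟨v, hv, hvo⟩ := decomp_ne hw hw0
  obtain ⟨w', hw', e'⟩ := occurs_iff.1 hvo
  have hvo' : CharOccurs v (indChar H f) := by
    rw [occurs_iff]
    exact ⟨u + w', hu.isChar.add hw', by rw [e, e']; abel⟩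
  obtain ⟨n, hn⟩ := ip_of_occurs (occ_res H hf hu ho) hf.isChar
  obtain ⟨m, hm⟩ := ip_of_occurs (occ_res H hf hv hvo') hf.isChar
  obtain ⟨l, hl⟩ := ip_nat hf.isChar (hw'.res H)
  obtain ⟨a, ha, ha'⟩ := ip_self_pos hf
  rw [e, e', resChar_add, resChar_add, ip_add_right, ip_add_right, hn, hm, hl, ha'] at h
  norm_cast at h
  omega

theorem T3 {X : H → ℚ} (hX : IsIrrChar X) (hT : TT H X) {f : H → k} (hf : IsIrrChar f)
    (ho : CharOccurs f (bc k X)) : TightInd H (indChar H f) f := by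
  refine ⟨rfl, ?_, ?_⟩
  · obtain ⟨Z, ⟨W, rfl⟩, eZ⟩ := ri H hf.isChar
    refine ⟨W, by rw [one_smul, eZ], fun hocc => ?_⟩
    have := T1 H hX hT hf hf ho ho
    rw [eZ, ip_add_right] at this
    exact ip_ne_of_occurs hf hocc (by simpa using this)
  · intro f' hf' hg hocc
    have h1 := T1 H hX hT hf' hf (G1 hf hf' hg hX.isChar ho) ho
    have h2 := ip_ne_of_occurs hf' hocc
    rw [h1] at h2
    exact ip_ne_zero_eq hf' hf h2

theorem self_bc {X : H → ℚ} : CharOccurs X (bc ℚ X) := by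
  rw [occurs_iff]
  exact ⟨0, IsChar.zero, by ext; simp [bc]⟩

theorem T5 {X : H → ℚ} (hX : IsIrrChar X) (hT : TT H X) : IsIrrChar (indChar H X) :=
  T2 H hX hT

theorem T4 {X : H → ℚ} {f : H → k} (ho : CharOccurs f (bc k X)) :
    CharOccurs (indChar H f) (bc k (indChar H X)) := by
  obtain ⟨R, hR, e⟩ := occurs_iff.1 ho
  rw [← ind_bc, e, indChar_add, occurs_iff]
  exact ⟨_, hR.ind H, rfl⟩

theorem ip_tight {ψ : G → k} {φ : H → k} (hφ : IsIrrChar φ) (hm : CharMult φ (resChar H ψ) 1) :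
    ip φ (resChar H ψ) = ip φ φ := by
  obtain ⟨W, e, hW⟩ := hm
  rw [e, one_smul, ip_add_right]
  have : ip φ W.character = 0 := by
    by_contra h
    exact hW (occurs_of_ip hφ ⟨W, rfl⟩ h)
  rw [this, add_zero]

theorem tight_T {ψ : G → k} {φ : H → k} (hψ : IsIrrChar ψ) (hφ : IsIrrChar φ)
    (ht : TightInd H ψ φ) {X : H → ℚ} (hX : IsIrrChar X) (ho : CharOccurs φ (bc k X)) :
    TT H X := by
  obtain ⟨hind, hmult, hgal⟩ := ht
  have htm := ip_tight H hφ hmult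
  obtain ⟨Z, hZ, eZ⟩ := ri H hX.isChar
  unfold TT
  rw [eZ, ip_add_right]
  by_contra hcon
  have hXZ : ip X Z ≠ 0 := fun h => hcon (by rw [h, add_zero])
  obtain ⟨Z', hZ', eZ'⟩ := occurs_iff.1 (occurs_of_ip hX hZ hXZ)
  have hXk : IsChar (bc k X) := hX.isChar.map _
  have hkZ : ip φ (bc k Z) ≠ 0 := by
    have : bc k Z = bc k X + bc k Z' := by rw [eZ']; ext g; simp [bc]
    rw [this, ip_add_right]
    exact nat_add_ne (ip_nat hφ.isChar hXk) (ip_nat hφ.isChar (hZ'.map _)) (ip_ne_of_occurs hφ ho)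
  have e1 : resChar H (indChar H (bc k X)) = bc k X + bc k Z := by
    rw [ind_bc]
    ext h
    have := congrFun eZ h
    simp only [resChar, bc, Pi.add_apply] at this ⊢
    rw [this, map_add]
  obtain ⟨s, hs, es⟩ := hXk.decomp
  have : ∃ f ∈ s, ip φ (resChar H (indChar H f)) ≠ ip φ f := by
    by_contra! hall
    have h1 : ip φ (resChar H (indChar H (bc k X))) = ip φ (bc k X) := by
      rw [es, indChar_sum, resChar_sum, ip_sum_right, ip_sum_right, Multiset.map_map,
        Multiset.map_map]
      congr 1
      exact Multiset.map_congr rfl fun f hf => hall f hf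
    rw [e1, ip_add_right] at h1
    exact hkZ (by simpa using h1)
  obtain ⟨f, hfs, hfne⟩ := this
  have hf := hs f hfs
  have hof : CharOccurs f (bc k X) := by rw [es]; exact occurs_of_mem hs hfs
  have hindf : IsChar (indChar H f) := hf.isChar.ind H
  have hn0 : ip φ (resChar H (indChar H f)) ≠ 0 := by
    obtain ⟨Zf, hZf, eZf⟩ := ri H hf.isChar
    rw [eZf, ip_add_right] at hfne ⊢
    rw [add_comm]
    refine nat_add_ne (ip_nat hφ.isChar hZf) (ip_nat hφ.isChar hf.isChar) ?_
    intro h0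
    exact hfne (by rw [h0, add_zero])
  rw [frob' H φ hindf, ← hind] at hn0
  have hN : ∀ g : G, g ^ Fintype.card G = 1 := fun g => pow_card_eq_one
  have hNH : ∀ g : H, g ^ Fintype.card G = 1 := fun g => Subtype.ext (by simp [hN])
  obtain ⟨σ, r, hr, hfr⟩ := P1 (Fintype.card G) hNH hX hφ hf ho hof
  have e2 : indChar H f = (r : k) • tw (Fintype.card G) σ ψ := by
    rw [hfr, indChar_smul, hind]
    congr 1
    exact indChar_pow H φ (pw _ σ) (pw _ σ⁻¹) (fun g => pw_inv _ σ (hN g))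
  have htw : tw (Fintype.card G) σ ψ = ψ := by
    apply P2 _ hN hψ
    intro h0
    rw [e2, ip_smul_right, h0, mul_zero] at hn0
    exact hn0 rfl
  rw [htw] at e2
  obtain ⟨a, ha, ha'⟩ := ip_self_pos hφ
  have hψψ : ip ψ ψ = a := by
    rw [← ha', ← htm, frob' H φ hψ.isChar, ← hind]
  have hfψ : ip f (resChar H ψ) = r * a := by
    rw [frob' H f hψ.isChar, e2, ip_smul_left, hψψ]
  have hff : ip f f = r * (r * a) := by
    rw [hfr, ip_smul_left, ip_smul_right, ip_tw _ hNH, ha']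
  have hr0 : (r : k) ≠ 0 := by exact_mod_cast hr.ne'
  have ha0 : (a : k) ≠ 0 := by exact_mod_cast ha.ne'
  have hocc : CharOccurs f (resChar H ψ) := by
    apply occurs_of_ip hf (hψ.isChar.res H)
    rw [hfψ]; exact mul_ne_zero hr0 ha0
  have hocc2 : CharOccurs ψ (indChar H f) := by
    apply occurs_of_ip hψ hindf hn0
  obtain ⟨n, hn⟩ := ip_of_occurs hocc hf.isChar
  obtain ⟨m, hm⟩ := ip_of_occurs hocc2 hψ.isChar
  rw [hfψ, hff] at hn
  rw [e2, ip_smul_right, hψψ] at hm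
  have hn' : r * (a : ℚ) = r * (r * a) + n := by exact_mod_cast hn
  have hm' : r * (a : ℚ) = a + m := by exact_mod_cast hm
  have haq : (0 : ℚ) < a := by exact_mod_cast ha
  have r1 : 1 ≤ r := by
    by_contra! hlt
    have : (0 : ℚ) ≤ m := by positivity
    nlinarith
  have r2 : r ≤ 1 := by
    by_contra! hlt
    have : (0 : ℚ) ≤ n := by positivity
    have : 0 < r * a := by positivity
    nlinarith
  have hr1 : r = 1 := le_antisymm r2 r1
  have hft : f = tw (Fintype.card G) σ φ := by
    rw [hfr, hr1]; simp
  have hg : IsGaloisConj φ f := by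
    rw [hft]
    exact tw_galois _ (hφ.isChar.good _ hNH) σ
  have hfφ := hgal f hf hg hocc
  apply hfne
  rw [hfφ, ← hind, htm]

end

theorem main_aux (G : Type) [Group G] [Fintype G]
    (k : Type) [Field k] [CharZero k] (L : Type) [Field L] [CharZero L]
    (H : Subgroup G)
    (ψ : FDRep k G) (hψ : IsIrr ψ) (φ : FDRep k H) (hφ : IsIrr φ)
    (hind : ψ.character = indChar H φ.character) :
    (TightInd H ψ.character φ.character ↔
      (∀ (χψ : FDRep ℚ G) (χφ : FDRep ℚ H), IsRatForm χψ ψ → IsRatForm χφ φ →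
        TightInd H χψ.character χφ.character)) ∧
    (TightInd H ψ.character φ.character ↔
      ((∀ ψ' : FDRep L G, IsIrr ψ' → Quasiconj ψ ψ' →
          ∃! cφ' : H → L,
            (∃ φ' : FDRep L H, IsIrr φ' ∧ Quasiconj φ φ' ∧ cφ' = φ'.character) ∧
            TightInd H ψ'.character cφ') ∧
        (∀ φ' : FDRep L H, IsIrr φ' → Quasiconj φ φ' →
          ∃! cψ' : G → L,
            (∃ ψ' : FDRep L G, IsIrr ψ' ∧ Quasiconj ψ ψ' ∧ cψ' = ψ'.character) ∧
            TightInd H cψ' φ'.character))) := by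
  haveI : Fintype H := Fintype.ofFinite H
  have hψc : IsIrrChar ψ.character := ⟨ψ, hψ, rfl⟩
  have hφc : IsIrrChar φ.character := ⟨φ, hφ, rfl⟩
  obtain ⟨X, hX, hXo⟩ := U2 hφc
  obtain ⟨χ, hχ, hχX⟩ := id hX
  have hrf : IsRatForm χ φ := ⟨hχ, by rw [← hχX]; exact hXo⟩
  have hrfX : ∀ {l : Type} [Field l] [CharZero l] (V : FDRep l H),
      CharOccurs V.character (bc l X) → IsRatForm χ V := by
    intro l _ _ V hV
    exact ⟨hχ, by rw [← hχX]; exact hV⟩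
  have hrfu : ∀ χ' : FDRep ℚ H, IsRatForm χ' φ → χ'.character = X := by
    intro χ' h
    exact U1 ⟨χ', h.1, rfl⟩ hX hφc h.2 hXo
  have hqX : ∀ φ' : FDRep L H, Quasiconj φ φ' → CharOccurs φ'.character (bc L X) := by
    rintro φ' ⟨χ', h1, h2⟩
    rw [← hrfu χ' h1]
    exact h2.2
  have haT : TightInd H ψ.character φ.character ↔ TT H X := by
    constructor
    · intro h; exact tight_T H hψc hφc h hX hXo
    · intro h; rw [hind]; exact T3 H hX h hφc hXo
  have hY : TT H X → ∀ χ' : FDRep ℚ G, IsRatForm χ' ψ → χ'.character = indChar H X := by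
    intro hT χ' h
    refine U1 ⟨χ', h.1, rfl⟩ (T5 H hX hT) hψc h.2 ?_
    rw [hind]; exact T4 H hXo
  rw [haT]
  refine ⟨⟨?_, ?_⟩, ⟨?_, ?_⟩⟩
  · intro hT χψ χφ h1 h2
    rw [hY hT χψ h1, hrfu χφ h2]
    exact T3 H hX hT hX (self_bc H)
  · intro h
    obtain ⟨Y, ⟨χψ, hχψ, rfl⟩, hYo⟩ := U2 hψc
    have := h χψ χ ⟨hχψ, hYo⟩ hrf
    rw [← hχX] at this
    exact tight_T H ⟨χψ, hχψ, rfl⟩ hX this hX (self_bc H)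
  · intro hT
    constructor
    · rintro ψ' hψ' ⟨χ', h1, h2⟩
      have hψ'c : IsIrrChar ψ'.character := ⟨ψ', hψ', rfl⟩
      have ho : CharOccurs ψ'.character (bc L (indChar H X)) := by
        rw [← hY hT χ' h1]; exact h2.2
      have hXL : IsChar (bc L X) := hX.isChar.map _
      obtain ⟨s, hs, es⟩ := hXL.decomp
      have hne := ip_ne_of_occurs hψ'c ho
      rw [← ind_bc, es, indChar_sum] at hne
      obtain ⟨u, hu, hune⟩ := exists_of_sum hne
      obtain ⟨f, hfs, rfl⟩ := Multiset.mem_map.1 hu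
      have hf := hs f hfs
      have hfo : CharOccurs f (bc L X) := by rw [es]; exact occurs_of_mem hs hfs
      have hfirr := T2 H hf (T1 H hX hT hf hf hfo hfo)
      have heq : ψ'.character = indChar H f := ip_ne_zero_eq hψ'c hfirr hune
      refine ⟨f, ⟨?_, ?_⟩, ?_⟩
      · obtain ⟨φ', hφ', rfl⟩ := id hf
        exact ⟨φ', hφ', ⟨χ, hrf, hrfX φ' hfo⟩, rfl⟩
      · rw [heq]; exact T3 H hX hT hf hfo
      · rintro _ ⟨⟨φ'', hφ'', hq, rfl⟩, ht⟩
        have hc : IsIrrChar φ''.character := ⟨φ'', hφ'', rfl⟩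
        have h3 := T1 H hX hT hf hc hfo (hqX φ'' hq)
        rw [← ht.1, heq, T1 H hX hT hf hf hfo hfo] at h3
        refine (ip_ne_zero_eq hf hc ?_).symm
        rw [← h3]
        exact (ip_ne_iff hf hf).2 rfl
    · intro φ' hφ' hq
      have hc : IsIrrChar φ'.character := ⟨φ', hφ', rfl⟩
      have ho := hqX φ' hq
      have hirr := T2 H hc (T1 H hX hT hc hc ho ho)
      refine ⟨indChar H φ'.character, ⟨?_, T3 H hX hT hc ho⟩, ?_⟩
      · obtain ⟨ψ', hψ', e⟩ := id hirr
        obtain ⟨Y, hY', eY⟩ := id (T5 H hX hT)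
        refine ⟨ψ', hψ', ⟨Y, ⟨hY', ?_⟩, ⟨hY', ?_⟩⟩, e⟩
        · rw [← eY, hind]; exact T4 H hXo
        · rw [← eY, ← e]; exact T4 H ho
      · rintro c ⟨_, ht⟩
        exact ht.1
  · rintro ⟨_, h⟩
    have hXL : IsChar (bc L X) := hX.isChar.map _
    obtain ⟨f, hf, hfo⟩ := decomp_ne hXL (by
      intro h0
      obtain ⟨n, hn, hn'⟩ := hX.one
      have := congrFun h0 1
      simp [bc, hn', hn.ne'] at this)
    obtain ⟨φ', hφ', rfl⟩ := id hf
    obtain ⟨_, ⟨⟨ψ', hψ', _, rfl⟩, ht⟩, _⟩ := h φ' hφ' ⟨χ, hrf, hrfX φ' hfo⟩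
    exact tight_T H ⟨ψ', hψ', rfl⟩ hf ht hX hfo

end Genotype

namespace Genotype

/-- **The Field-Changing Theorem.** Let `H ≤ G`, let the `𝕂G`-irrep `ψ` be induced from
the `𝕂H`-irrep `φ`, and let `𝕃` be any field of characteristic zero. The following are
equivalent: (a) `ψ` is tightly induced from `φ`; (b) `ψ_ℚ` is tightly induced from `φ_ℚ`;
(c) tight induction gives a bijective correspondence between the (isomorphism classes of)
`𝕃G`-irreps quasiconjugate to `ψ` and the `𝕃H`-irreps quasiconjugate to `φ`. -/
theorem field_changing_theorem (p : ℕ) (hp : p.Prime)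
    (G : Type) [Group G] [Fintype G] (hG : IsPGroup p G)
    (k : Type) [Field k] [CharZero k] (L : Type) [Field L] [CharZero L]
    (H : Subgroup G)
    (ψ : FDRep k G) (hψ : IsIrr ψ) (φ : FDRep k H) (hφ : IsIrr φ)
    (hind : ψ.character = indChar H φ.character) :
    (TightInd H ψ.character φ.character ↔
      (∀ (χψ : FDRep ℚ G) (χφ : FDRep ℚ H), IsRatForm χψ ψ → IsRatForm χφ φ →
        TightInd H χψ.character χφ.character)) ∧
    (TightInd H ψ.character φ.character ↔
      ((∀ ψ' : FDRep L G, IsIrr ψ' → Quasiconj ψ ψ' →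
          ∃! cφ' : H → L,
            (∃ φ' : FDRep L H, IsIrr φ' ∧ Quasiconj φ φ' ∧ cφ' = φ'.character) ∧
            TightInd H ψ'.character cφ') ∧
        (∀ φ' : FDRep L H, IsIrr φ' → Quasiconj φ φ' →
          ∃! cψ' : G → L,
            (∃ ψ' : FDRep L G, IsIrr ψ' ∧ Quasiconj ψ ψ' ∧ cψ' = ψ'.character) ∧
            TightInd H cψ' φ'.character))) := by
  exact main_aux G k L H ψ hψ φ hφ hind

end Genotype
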